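/- arXiv:math/0505129 — 2 statements merged into one kernel-verified Lean document; each statement's English description precedes it below -/
import Mathlib

section
/- Let a and b be relatively prime positive integers. Then for every nonnegative integer n, the number of pairs (x,y) ∈ ℤ₊² with ax + by = n equals n/(ab) + (a+b)/(2ab) + (1/a)·∑_{k=1}^{a−1} e^{2πink/a}/(1 − e^{−2πibk/a}) + (1/b)·∑_{k=1}^{b−1} e^{2πink/b}/(1 − e^{−2πiak/b}). -/
open Complex

/-- For a primitive `a`-th root of unity `ζ`, the contribution of the nontrivial powers of `ζ` to the
partial fraction decomposition of `1 / ((1 - z ^ a) (1 - z ^ b))`, up to the factor `1 / a`. -/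
noncomputable def rootSum (ζ : ℂ) (a b : ℕ) (n : ℤ) : ℂ :=
  ∑ k ∈ Finset.Icc 1 (a - 1), ζ ^ (n * k) / (1 - ζ ^ (-((b : ℤ) * k)))

section RootSum

variable {ζ : ℂ} {a b : ℕ}

lemma IsPrimitiveRoot.one_sub_zpow_ne_zero (hζ : IsPrimitiveRoot ζ a) (hab : a.Coprime b) {k : ℕ}
    (hk : k ∈ Finset.Icc 1 (a - 1)) : 1 - ζ ^ (-((b : ℤ) * k)) ≠ 0 := by
  rw [Finset.mem_Icc] at hk
  rw [sub_ne_zero, ne_comm, Ne, hζ.zpow_eq_one_iff_dvd, dvd_neg]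
  intro h
  have h' : a ∣ k := hab.dvd_of_dvd_mul_left (by exact_mod_cast h)
  have := Nat.le_of_dvd (by omega) h'
  omega

lemma IsPrimitiveRoot.sum_Icc_zpow (hζ : IsPrimitiveRoot ζ a) (ha : 0 < a) (n : ℤ) :
    ∑ k ∈ Finset.Icc 1 (a - 1), ζ ^ (n * k) = (if (a : ℤ) ∣ n then (a : ℂ) else 0) - 1 := by
  have hrange : ∑ k ∈ Finset.range a, (ζ ^ n) ^ k = if (a : ℤ) ∣ n then (a : ℂ) else 0 := by
    split_ifs with h
    · simp [(hζ.zpow_eq_one_iff_dvd n).2 h]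
    · have hne : ζ ^ n ≠ 1 := fun h' => h ((hζ.zpow_eq_one_iff_dvd n).1 h')
      have hpow : (ζ ^ n) ^ a = 1 := by
        rw [← zpow_natCast, ← zpow_mul, hζ.zpow_eq_one_iff_dvd]
        exact dvd_mul_left _ _
      rw [geom_sum_eq hne, hpow, sub_self, zero_div]
  rw [← hrange]
  have hinsert : Finset.range a = insert 0 (Finset.Icc 1 (a - 1)) := by
    ext k
    simp only [Finset.mem_range, Finset.mem_insert, Finset.mem_Icc]
    omega
  rw [hinsert, Finset.sum_insert (by simp), pow_zero, add_sub_cancel_left]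
  exact Finset.sum_congr rfl fun k _ => by rw [zpow_mul, zpow_natCast]

lemma rootSum_sub (hζ : IsPrimitiveRoot ζ a) (ha : 0 < a) (hab : a.Coprime b) (n : ℤ) :
    rootSum ζ a b n - rootSum ζ a b (n - b) = (if (a : ℤ) ∣ n then (a : ℂ) else 0) - 1 := by
  rw [← hζ.sum_Icc_zpow ha, rootSum, rootSum, ← Finset.sum_sub_distrib]
  refine Finset.sum_congr rfl fun k hk => ?_
  have h := hζ.one_sub_zpow_ne_zero hab hk
  rw [← sub_div, div_eq_iff h, sub_mul, sub_eq_add_neg (n * (k : ℤ)),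
    zpow_add₀ (hζ.ne_zero ha.ne')]
  ring

lemma rootSum_sub_self (hζ : IsPrimitiveRoot ζ a) (ha : 0 < a) (n : ℤ) :
    rootSum ζ a b (n - a) = rootSum ζ a b n := by
  refine Finset.sum_congr rfl fun k _ => ?_
  have h : ζ ^ ((a : ℤ) * k) = 1 := (hζ.zpow_eq_one_iff_dvd _).2 (dvd_mul_right _ _)
  rw [sub_mul, zpow_sub₀ (hζ.ne_zero ha.ne'), h, div_one]

lemma rootSum_neg (hζ : IsPrimitiveRoot ζ a) (ha : 0 < a) (hab : a.Coprime b) :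
    rootSum ζ a b (-b) = -rootSum ζ a b 0 := by
  have h0 := hζ.ne_zero ha.ne'
  rw [rootSum, rootSum, ← Finset.sum_neg_distrib]
  refine Finset.sum_bij' (fun k _ => a - k) (fun k _ => a - k) ?_ ?_ ?_ ?_ ?_
  · intro k hk; rw [Finset.mem_Icc] at *; omega
  · intro k hk; rw [Finset.mem_Icc] at *; omega
  · intro k hk; rw [Finset.mem_Icc] at hk; omega
  · intro k hk; rw [Finset.mem_Icc] at hk; omega
  · intro k hk
    have h := hζ.one_sub_zpow_ne_zero hab hk
    have hka : k ≤ a := by rw [Finset.mem_Icc] at hk; omega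
    have hrefl : ζ ^ (-((b : ℤ) * (a - k : ℕ))) = (ζ ^ (-((b : ℤ) * k)))⁻¹ := by
      have h1 : ζ ^ ((a : ℤ) * -b) = 1 := (hζ.zpow_eq_one_iff_dvd _).2 (dvd_mul_right _ _)
      rw [← zpow_neg, Nat.cast_sub hka,
        show -((b : ℤ) * (a - k)) = a * -b + - -(b * k) by ring, zpow_add₀ h0, h1, one_mul]
    have hz : ζ ^ (-((b : ℤ) * k)) ≠ 0 := zpow_ne_zero _ h0
    rw [hrefl, zero_mul, zpow_zero, neg_mul]
    generalize ζ ^ (-((b : ℤ) * k)) = z at *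
    have h' : z - 1 ≠ 0 := by rwa [← neg_sub, neg_ne_zero]
    field_simp
    ring

end RootSum

/-- Splitting off the solutions with vanishing second coordinate. -/
lemma ncard_linear_eq {a b : ℕ} (ha : 0 < a) (hb : 0 < b) (n : ℕ) :
    {p : ℕ × ℕ | a * p.1 + b * p.2 = n}.ncard =
      {p : ℕ × ℕ | a * p.1 + b * p.2 + b = n}.ncard + if a ∣ n then 1 else 0 := by
  have hfin : {p : ℕ × ℕ | a * p.1 + b * p.2 = n}.Finite := by
    refine ((Finset.range (n + 1)) ×ˢ (Finset.range (n + 1))).finite_toSet.subset ?_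
    rintro ⟨x, y⟩ h
    simp only [Set.mem_ofPred_eq] at h
    simp only [Finset.coe_product, Finset.coe_range, Set.mem_prod, Set.mem_Iio]
    constructor <;> nlinarith
  have hsplit : {p : ℕ × ℕ | a * p.1 + b * p.2 = n} =
      Set.image (Prod.map id Nat.succ) {p : ℕ × ℕ | a * p.1 + b * p.2 + b = n} ∪
        {p : ℕ × ℕ | a * p.1 = n ∧ p.2 = 0} := by
    ext ⟨x, y⟩
    cases y <;> simp [mul_add, add_assoc]
  have hdisj : Disjoint (Set.image (Prod.map id Nat.succ) {p : ℕ × ℕ | a * p.1 + b * p.2 + b = n})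
      {p : ℕ × ℕ | a * p.1 = n ∧ p.2 = 0} := by
    rw [Set.disjoint_left]
    rintro _ ⟨p, -, rfl⟩ ⟨-, h⟩
    exact Nat.succ_ne_zero _ h
  have hzero : {p : ℕ × ℕ | a * p.1 = n ∧ p.2 = 0}.ncard = if a ∣ n then 1 else 0 := by
    split_ifs with h
    · obtain ⟨c, rfl⟩ := h
      rw [Set.ncard_eq_one]
      refine ⟨(c, 0), ?_⟩
      ext ⟨x, y⟩
      simp [ha.ne']
    · rw [Set.ncard_eq_zero (hfin.subset (hsplit ▸ Set.subset_union_right)),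
        Set.eq_empty_iff_forall_notMem]
      rintro p ⟨hp, -⟩
      exact h ⟨p.1, hp.symm⟩
  have hinj : Function.Injective (Prod.map id Nat.succ : ℕ × ℕ → ℕ × ℕ) :=
    Function.injective_id.prodMap Nat.succ_injective
  rw [← hzero, ← Set.ncard_image_of_injective {p : ℕ × ℕ | a * p.1 + b * p.2 + b = n} hinj,
    ← Set.ncard_union_eq hdisj (hfin.subset (hsplit ▸ Set.subset_union_left))
      (hfin.subset (hsplit ▸ Set.subset_union_right)), ← hsplit]

section Recursion

variable {a b : ℕ} {F : ℤ → ℂ}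

/-- The functional equations determine `F` on the interval `[0, b)`. -/
lemma eq_ite_of_recursion (ha : 0 < a) (hb : 0 < b) (hab : a.Coprime b)
    (hFb : ∀ n, F n - F (n - b) = if (a : ℤ) ∣ n then 1 else 0)
    (hFa : ∀ n, F n - F (n - a) = if (b : ℤ) ∣ n then 1 else 0)
    (hneg : F (-b - a) = -F 0) {n : ℕ} (hn : n < b) :
    F n = if a ∣ n then 1 else 0 := by
  have hzero : F 0 = 1 := by
    have h1 := hFb 0
    have h2 := hFa (-b)
    simp only [dvd_zero, dvd_neg, dvd_refl, if_true, zero_sub, hneg] at h1 h2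
    linear_combination (h1 + h2) / 2
  have hmul (x : ℕ) (hx : x < b) : F (a * x) = 1 := by
    induction x with
    | zero => simpa using hzero
    | succ x ih =>
      have h := hFa (a * (x + 1 : ℕ))
      have hnd : ¬ (b : ℤ) ∣ a * (x + 1 : ℕ) := fun hd =>
        absurd (Nat.le_of_dvd (by omega)
          (hab.symm.dvd_of_dvd_mul_left (n := x + 1) (by exact_mod_cast hd))) (by omega)
      rw [if_neg hnd, show (a : ℤ) * (x + 1 : ℕ) - a = a * x by push_cast; ring,
        ih (by omega)] at h
      linear_combination h
  have hmul_sub (x : ℕ) (hx : x < b) (j : ℕ) (hj : j < a) : F (a * x - b * (j + 1 : ℕ)) = 0 := by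
    induction j with
    | zero =>
      have h := hFb (a * x)
      rw [if_pos (dvd_mul_right _ _), hmul x hx] at h
      simp only [zero_add, Nat.cast_one, mul_one]
      linear_combination -h
    | succ j ih =>
      have h := hFb (a * x - b * (j + 1 : ℕ))
      have hnd : ¬ (a : ℤ) ∣ a * x - b * (j + 1 : ℕ) := fun hd =>
        absurd (Nat.le_of_dvd (by omega) (hab.dvd_of_dvd_mul_left (m := b) (n := j + 1)
          (by exact_mod_cast (dvd_sub_right (dvd_mul_right (a : ℤ) x)).1 hd))) (by omega)
      rw [if_neg hnd, ih (by omega)] at h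
      rw [show (a : ℤ) * x - b * (j + 1 + 1 : ℕ) = a * x - b * (j + 1 : ℕ) - b by push_cast; ring]
      linear_combination -h
  split_ifs with h
  · obtain ⟨x, rfl⟩ := h
    have := hmul x (by nlinarith)
    exact_mod_cast this
  · obtain ⟨x, hx, hmod⟩ : ∃ x < b, a * x ≡ n [MOD b] :=
      Nat.exists_mul_mod_eq_of_coprime n hab hb.ne'
    obtain ⟨y, hy⟩ := hmod.dvd
    push_cast at hy
    have hxb : (x : ℤ) < b := by exact_mod_cast hx
    have hnb : (n : ℤ) < b := by exact_mod_cast hn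
    have hy0 : y ≠ 0 := by
      rintro rfl
      exact h ⟨x, by zify; linarith⟩
    have hy1 : y < 1 := by nlinarith
    have hya : -(a : ℤ) < y := by
      by_contra! hcon
      nlinarith
    obtain ⟨j, hj⟩ : ∃ j : ℕ, y = -(j + 1 : ℕ) := ⟨(-y - 1).toNat, by omega⟩
    have := hmul_sub x hx j (by omega)
    rwa [show (a : ℤ) * x - b * (j + 1 : ℕ) = n by rw [hj] at hy; linarith] at this

/-- A function satisfying the functional equations counts the representations of `n` as
`a * x + b * y`. -/
lemma ncard_linear_eq_of_recursion (ha : 0 < a) (hb : 0 < b) (hab : a.Coprime b)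
    (hFb : ∀ n, F n - F (n - b) = if (a : ℤ) ∣ n then 1 else 0)
    (hFa : ∀ n, F n - F (n - a) = if (b : ℤ) ∣ n then 1 else 0)
    (hneg : F (-b - a) = -F 0) (n : ℕ) :
    ({p : ℕ × ℕ | a * p.1 + b * p.2 = n}.ncard : ℂ) = F n := by
  induction n using Nat.strong_induction_on with
  | _ n ih =>
    rw [ncard_linear_eq ha hb]
    rcases lt_or_ge n b with hn | hn
    · have hempty : {p : ℕ × ℕ | a * p.1 + b * p.2 + b = n} = ∅ := by
        rw [Set.eq_empty_iff_forall_notMem]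
        intro p (hp : _ = _)
        omega
      rw [hempty, eq_ite_of_recursion ha hb hab hFb hFa hneg hn]
      simp
    · obtain ⟨m, rfl⟩ := Nat.exists_eq_add_of_le' hn
      have h := hFb (m + b : ℕ)
      rw [show ((m + b : ℕ) : ℤ) - b = m by push_cast; ring, ← ih m (by omega)] at h
      simp only [Int.natCast_dvd_natCast] at h
      simp only [add_left_inj]
      rw [Nat.cast_add, Nat.cast_ite, Nat.cast_one, Nat.cast_zero]
      linear_combination -h

end Recursion

lemma sum_exp_eq_rootSum (a b n : ℕ) :
    ∑ k ∈ Finset.Icc 1 (a - 1),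
        Complex.exp (2 * (Real.pi : ℂ) * I * (n : ℂ) * (k : ℂ) / (a : ℂ))
          / (1 - Complex.exp (-(2 * (Real.pi : ℂ) * I * (b : ℂ) * (k : ℂ) / (a : ℂ)))) =
      rootSum (Complex.exp (2 * Real.pi * I / a)) a b n := by
  refine Finset.sum_congr rfl fun k _ => ?_
  rw [← Complex.exp_int_mul, ← Complex.exp_int_mul]
  push_cast
  congr 3
  · ring
  · ring

/-- If `a` and `b` are relatively prime positive integers, then for every nonnegative
integer `n`, the number of pairs `(x, y)` of nonnegative integers with `a*x + b*y = n`
equals `n/(ab) + (a+b)/(2ab) + (1/a)·∑_{k=1}^{a-1} e^{2πink/a}/(1 - e^{-2πibk/a})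
+ (1/b)·∑_{k=1}^{b-1} e^{2πink/b}/(1 - e^{-2πiak/b})`. -/
theorem partition_function_explicit_formula (a b : ℕ) (ha : 0 < a) (hb : 0 < b)
    (hab : Nat.Coprime a b) (n : ℕ) :
    (Nat.card {p : ℕ × ℕ // a * p.1 + b * p.2 = n} : ℂ) =
      (n : ℂ) / ((a : ℂ) * (b : ℂ)) + ((a : ℂ) + (b : ℂ)) / (2 * (a : ℂ) * (b : ℂ))
        + (1 / (a : ℂ)) * ∑ k ∈ Finset.Icc 1 (a - 1),
            Complex.exp (2 * (Real.pi : ℂ) * I * (n : ℂ) * (k : ℂ) / (a : ℂ))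
              / (1 - Complex.exp (-(2 * (Real.pi : ℂ) * I * (b : ℂ) * (k : ℂ) / (a : ℂ))))
        + (1 / (b : ℂ)) * ∑ k ∈ Finset.Icc 1 (b - 1),
            Complex.exp (2 * (Real.pi : ℂ) * I * (n : ℂ) * (k : ℂ) / (b : ℂ))
              / (1 - Complex.exp (-(2 * (Real.pi : ℂ) * I * (a : ℂ) * (k : ℂ) / (b : ℂ)))) := by
  have ha' : (a : ℂ) ≠ 0 := Nat.cast_ne_zero.2 ha.ne'
  have hb' : (b : ℂ) ≠ 0 := Nat.cast_ne_zero.2 hb.ne'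
  have hζ := Complex.isPrimitiveRoot_exp a ha.ne'
  have hξ := Complex.isPrimitiveRoot_exp b hb.ne'
  rw [sum_exp_eq_rootSum, sum_exp_eq_rootSum]
  generalize Complex.exp (2 * Real.pi * I / a) = ζ at *
  generalize Complex.exp (2 * Real.pi * I / b) = ξ at *
  refine ncard_linear_eq_of_recursion (F := fun m : ℤ => (m : ℂ) / ((a : ℂ) * (b : ℂ))
    + ((a : ℂ) + (b : ℂ)) / (2 * (a : ℂ) * (b : ℂ)) + (1 / (a : ℂ)) * rootSum ζ a b m
    + (1 / (b : ℂ)) * rootSum ξ b a m) ha hb hab (fun m => ?_) (fun m => ?_) ?_ n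
  · have h := rootSum_sub hζ ha hab m
    simp only [rootSum_sub_self hξ hb]
    split_ifs at h ⊢ <;> push_cast <;> field_simp <;> linear_combination 2 * b * h
  · have h := rootSum_sub hξ hb hab.symm m
    simp only [rootSum_sub_self hζ ha]
    split_ifs at h ⊢ <;> push_cast <;> field_simp <;> linear_combination 2 * a * h
  · have h := rootSum_neg hζ ha hab
    have h' := rootSum_neg hξ hb hab.symm
    have hshift : rootSum ξ b a (-b - a) = rootSum ξ b a (-a) := by
      rw [← rootSum_sub_self hξ hb (-a)]
      congr 1
      ring
    simp only [rootSum_sub_self hζ ha, hshift, h, h']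
    push_cast
    field_simp
    ring
end

section
/- Let M be an s×n integer matrix (n ≥ s ≥ 1) whose columns span ℝˢ and whose convex hull does not contain the origin, and suppose M is 1-prime. Let Ω be a fundamental M-cone. Then there exists a polynomial P : ℝˢ → ℂ of degree at most n − s such that for every α ∈ closure(Ω) ∩ ℤˢ, t(α|M) = P(α) + ∑_{θ∈A(M)∖{e}} θ^α · (1/|det M_θ|) · ∏_{w∈M∖M_θ} (1 − θ^{−w})^{−1} · 1_{cone(M_θ)}(Ω), where for θ ≠ e the set M_θ consists of exactly s columns and is regarded as an s×s matrix, and 1_{cone(M_θ)}(Ω) equals 1 if Ω ∩ cone(M_θ) ≠ ∅ and 0 otherwise. -/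
open MeasureTheory Matrix
open scoped ENNReal Classical

/-- The `j`-th column of `M`, as a vector of `ℝˢ`. -/
def col (s n : ℕ) (M : Matrix (Fin s) (Fin n) ℤ) (j : Fin n) : Fin s → ℝ :=
  fun i => (M i j : ℝ)

/-- The cone spanned by the columns of `M` with indices in `J`. -/
def coneOf (s n : ℕ) (M : Matrix (Fin s) (Fin n) ℤ) (J : Finset (Fin n)) :
    Set (Fin s → ℝ) :=
  {x | ∃ a : Fin n → ℝ, (∀ j, 0 ≤ a j) ∧ (∀ j ∉ J, a j = 0) ∧ x = ∑ j, a j • col s n M j}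

/-- `c(M)`: the union of `cone(M∖Y)` over column subsets `Y` with `M∖Y` not
spanning `ℝˢ`. -/
def badSet (s n : ℕ) (M : Matrix (Fin s) (Fin n) ℤ) : Set (Fin s → ℝ) :=
  ⋃ J ∈ {J : Finset (Fin n) | Submodule.span ℝ (col s n M '' ↑J) ≠ ⊤}, coneOf s n M J

/-- `Ω` is a fundamental `M`-cone: a connected component of `cone°(M) ∖ c(M)`. -/
def IsFundCone (s n : ℕ) (M : Matrix (Fin s) (Fin n) ℤ) (Ω : Set (Fin s → ℝ)) : Prop :=
  ∃ x ∈ interior (coneOf s n M Finset.univ) \ badSet s n M,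
    Ω = connectedComponentIn (interior (coneOf s n M Finset.univ) \ badSet s n M) x

/-- `θ^y := θ₁^{y₁} ⋯ θ_s^{y_s}` for `θ ∈ ℂˢ` and `y ∈ ℤˢ`. -/
noncomputable def charP (s : ℕ) (θ : Fin s → ℂ) (y : Fin s → ℤ) : ℂ := ∏ i, θ i ^ y i

/-- `A(M)`: the set of `θ ∈ (ℂ∖{0})ˢ` such that the columns `m` of `M` with `θ^m = 1`
span `ℝˢ`. -/
def Aset (s n : ℕ) (M : Matrix (Fin s) (Fin n) ℤ) : Set (Fin s → ℂ) :=
  {θ | (∀ i, θ i ≠ 0) ∧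
    Submodule.span ℝ (col s n M '' {j | charP s θ (fun i => M i j) = 1}) = ⊤}

/-- The index set of the columns constituting `M_θ`. -/
noncomputable def idxSet (s n : ℕ) (M : Matrix (Fin s) (Fin n) ℤ) (θ : Fin s → ℂ) :
    Finset (Fin n) :=
  (Set.toFinite {j : Fin n | charP s θ (fun i => M i j) = 1}).toFinset

/-- `M` is 1-prime: for every subset `Y` of the columns of `M` with `#Y = s+1` spanning
`ℝˢ`, the gcd of `|det X|` over the nonsingular `s×s` column submatrices `X` of `Y`
is `1`. -/
def IsOnePrime (s n : ℕ) (M : Matrix (Fin s) (Fin n) ℤ) : Prop :=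
  ∀ Y : Finset (Fin n), Y.card = s + 1 →
    Submodule.span ℝ (col s n M '' ↑Y) = ⊤ →
    Finset.gcd (Finset.univ.filter fun g : Fin s → Fin n =>
        (∀ i, g i ∈ Y) ∧ (M.submatrix id g).det ≠ 0)
      (fun g => (M.submatrix id g).det.natAbs) = 1

/-- `|det M_θ|`, realized in an ordering-free way as `√(det (N Nᵀ))` where `N` is the
`s × M_θ` matrix formed by the columns of `M_θ` (for a square `N` this is exactly
`|det N|`). -/
noncomputable def detAbs (s n : ℕ) (M : Matrix (Fin s) (Fin n) ℤ) (θ : Fin s → ℂ) : ℝ :=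
  Real.sqrt (((Matrix.of fun i (j : ↥(idxSet s n M θ)) => (M i (j : Fin n) : ℝ)) *
    (Matrix.of fun i (j : ↥(idxSet s n M θ)) => (M i (j : Fin n) : ℝ))ᵀ).det)

set_option linter.unusedSectionVars false

section Simplex

variable {ι V : Type*} [Fintype ι] [DecidableEq ι] [AddCommGroup V] [Module ℝ V]

/-- Every vector has a unique expansion in the family `m` supported on `B`. -/
def IsColBasis (m : ι → V) (B : Finset ι) : Prop :=
  ∀ x, ∃! a : ι → ℝ, (∀ j ∉ B, a j = 0) ∧ Fintype.linearCombination ℝ m a = x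

/-- The coefficients of the expansion of `x` in the basis `(m j)_{j ∈ B}`. -/
noncomputable def coef (m : ι → V) (B : Finset ι) (x : V) : ι → ℝ :=
  if h : ∃ a : ι → ℝ, (∀ j ∉ B, a j = 0) ∧ Fintype.linearCombination ℝ m a = x then h.choose else 0

namespace IsColBasis

variable {m : ι → V} {B : Finset ι}

theorem coef_of_notMem (hB : IsColBasis m B) (x : V) {j : ι} (hj : j ∉ B) : coef m B x j = 0 := by
  have h := (hB x).exists
  rw [coef, dif_pos h]
  exact h.choose_spec.1 j hj

theorem linearCombination_coef (hB : IsColBasis m B) (x : V) :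
    Fintype.linearCombination ℝ m (coef m B x) = x := by
  have h := (hB x).exists
  rw [coef, dif_pos h]
  exact h.choose_spec.2

theorem eq_coef (hB : IsColBasis m B) {a : ι → ℝ} (ha : ∀ j ∉ B, a j = 0) {x : V}
    (hx : Fintype.linearCombination ℝ m a = x) : a = coef m B x :=
  (hB x).unique ⟨ha, hx⟩ ⟨fun _ hj => hB.coef_of_notMem x hj, hB.linearCombination_coef x⟩

theorem coef_add (hB : IsColBasis m B) (x y : V) :
    coef m B (x + y) = coef m B x + coef m B y := by
  refine (hB.eq_coef (fun j hj => ?_) ?_).symm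
  · simp [hB.coef_of_notMem _ hj]
  · rw [map_add, hB.linearCombination_coef, hB.linearCombination_coef]

theorem coef_smul (hB : IsColBasis m B) (c : ℝ) (x : V) :
    coef m B (c • x) = c • coef m B x := by
  refine (hB.eq_coef (fun j hj => ?_) ?_).symm
  · simp [hB.coef_of_notMem _ hj]
  · rw [map_smul, hB.linearCombination_coef]

/-- `coef` as a linear map. -/
noncomputable def coefₗ (hB : IsColBasis m B) : V →ₗ[ℝ] (ι → ℝ) where
  toFun := coef m B
  map_add' := hB.coef_add
  map_smul' := hB.coef_smul

theorem coefₗ_apply (hB : IsColBasis m B) (x : V) : hB.coefₗ x = coef m B x := rfl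

theorem coef_linearCombination (hB : IsColBasis m B) (a : ι → ℝ) :
    coef m B (Fintype.linearCombination ℝ m a) = ∑ w, a w • coef m B (m w) := by
  rw [Fintype.linearCombination_apply, ← hB.coefₗ_apply, map_sum]
  simp only [map_smul, coefₗ_apply]

theorem coef_self (hB : IsColBasis m B) {j : ι} (hj : j ∈ B) :
    coef m B (m j) = Pi.single j 1 := by
  refine (hB.eq_coef (fun k hk => ?_) ?_).symm
  · rw [Pi.single_eq_of_ne]
    rintro rfl
    exact hk hj
  · simp

end IsColBasis

/-- The relation expressing `m w` through the basis `B`. -/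
noncomputable def circuit (m : ι → V) (B : Finset ι) (w : ι) : ι → ℝ :=
  Pi.single w 1 - coef m B (m w)

/-- The reduced cost of `w` with respect to the basis `B` and the cost vector `u`. -/
noncomputable def redCost (m : ι → V) (u : ι → ℝ) (B : Finset ι) (w : ι) : ℝ :=
  u ⬝ᵥ circuit m B w

section
variable {m : ι → V} {B : Finset ι}

theorem linearCombination_circuit (hB : IsColBasis m B) (w : ι) :
    Fintype.linearCombination ℝ m (circuit m B w) = 0 := by
  rw [circuit, map_sub, hB.linearCombination_coef]
  simp

theorem circuit_self (hB : IsColBasis m B) {w : ι} (hw : w ∉ B) : circuit m B w w = 1 := by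
  simp [circuit, hB.coef_of_notMem _ hw]

theorem circuit_of_notMem (hB : IsColBasis m B) {w j : ι} (hj : j ∉ B) (hjw : j ≠ w) :
    circuit m B w j = 0 := by
  simp [circuit, hB.coef_of_notMem _ hj, hjw]

theorem circuit_eq_zero (hB : IsColBasis m B) {w : ι} (hw : w ∈ B) : circuit m B w = 0 := by
  simp [circuit, hB.coef_self hw]

theorem redCost_eq (m : ι → V) (u : ι → ℝ) (B : Finset ι) (w : ι) :
    redCost m u B w = u w - u ⬝ᵥ coef m B (m w) := by
  simp [redCost, circuit, dotProduct_sub]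

theorem redCost_eq_zero (hB : IsColBasis m B) (u : ι → ℝ) {w : ι} (hw : w ∈ B) :
    redCost m u B w = 0 := by
  simp [redCost, circuit_eq_zero hB hw]

theorem dotProduct_eq_add_sum_redCost (hB : IsColBasis m B) (u a : ι → ℝ) :
    u ⬝ᵥ a = u ⬝ᵥ coef m B (Fintype.linearCombination ℝ m a) +
      ∑ w ∈ Bᶜ, a w * redCost m u B w := by
  have h : ∑ w ∈ Bᶜ, a w * redCost m u B w = ∑ w, a w * redCost m u B w := by
    refine Finset.sum_subset (Finset.subset_univ _) fun w _ hw => ?_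
    rw [redCost_eq_zero hB u (by simpa using hw), mul_zero]
  rw [h, hB.coef_linearCombination, dotProduct_sum]
  simp only [redCost_eq, mul_sub, Finset.sum_sub_distrib, dotProduct_smul, smul_eq_mul]
  rw [dotProduct_comm, dotProduct]
  ring

/-- Exchange: `w` enters the basis and `j` leaves it. -/
theorem IsColBasis.exchange (hB : IsColBasis m B) {w j : ι} (hw : w ∉ B) (hj : j ∈ B)
    (hc : circuit m B w j ≠ 0) : IsColBasis m (insert w (B.erase j)) := by
  have hwj : w ≠ j := fun h => hw (h ▸ hj)
  intro x
  refine ⟨coef m B x - (coef m B x j / circuit m B w j) • circuit m B w, ⟨fun k hk => ?_, ?_⟩, ?_⟩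
  · rw [Finset.mem_insert, Finset.mem_erase, not_or, not_and] at hk
    by_cases hkj : k = j
    · subst hkj
      simp [div_mul_cancel₀ _ hc]
    · simp [hB.coef_of_notMem x (hk.2 hkj), circuit_of_notMem hB (hk.2 hkj) hk.1]
  · rw [map_sub, map_smul, linearCombination_circuit hB, hB.linearCombination_coef]
    simp
  · rintro a ⟨ha, hax⟩
    have h1 : a - a w • circuit m B w = coef m B x := by
      refine hB.eq_coef (fun k hk => ?_) ?_
      · by_cases hkw : k = w
        · subst hkw
          simp [circuit_self hB hw]
        · have : a k = 0 := ha k (by simp [hkw, hk])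
          simp [this, circuit_of_notMem hB hk hkw]
      · rw [map_sub, map_smul, linearCombination_circuit hB, hax]
        simp
    have h2 : a j = 0 := ha j (by simp [hwj.symm])
    have h3 : coef m B x j = - (a w * circuit m B w j) := by
      rw [← h1]
      simp [h2]
    rw [← h1, h1, h3, neg_div, mul_div_cancel_right₀ _ hc, ← h1]
    simp

/-- After an exchange the circuit is rescaled. -/
theorem circuit_exchange (hB : IsColBasis m B) {w j : ι} (hw : w ∉ B) (hj : j ∈ B)
    (hc : circuit m B w j ≠ 0) :
    circuit m (insert w (B.erase j)) j = (circuit m B w j)⁻¹ • circuit m B w := by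
  have hwj : w ≠ j := fun h => hw (h ▸ hj)
  have hB' := hB.exchange hw hj hc
  have h : Pi.single j 1 - (circuit m B w j)⁻¹ • circuit m B w =
      coef m (insert w (B.erase j)) (m j) := by
    refine hB'.eq_coef (fun k hk => ?_) ?_
    · rw [Finset.mem_insert, Finset.mem_erase, not_or, not_and] at hk
      by_cases hkj : k = j
      · subst hkj
        simp [inv_mul_cancel₀ hc]
      · simp [circuit_of_notMem hB (hk.2 hkj) hk.1, hkj]
    · rw [map_sub, map_smul, linearCombination_circuit hB]
      simp
  rw [circuit, ← h]
  simp

theorem redCost_exchange_self (hB : IsColBasis m B) (u : ι → ℝ) {w j : ι} (hw : w ∉ B) (hj : j ∈ B)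
    (hc : circuit m B w j ≠ 0) :
    redCost m u (insert w (B.erase j)) j = (circuit m B w j)⁻¹ * redCost m u B w := by
  rw [redCost, circuit_exchange hB hw hj hc, dotProduct_smul, smul_eq_mul, redCost]

/-- If the entering element has reduced cost zero, an exchange does not change reduced costs. -/
theorem redCost_exchange (hB : IsColBasis m B) (u : ι → ℝ) {w j : ι} (hw : w ∉ B) (hj : j ∈ B)
    (hc : circuit m B w j ≠ 0) (h0 : redCost m u B w = 0) (v : ι) :
    redCost m u (insert w (B.erase j)) v = redCost m u B v := by
  have hB' := hB.exchange hw hj hc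
  have h := dotProduct_eq_add_sum_redCost hB u (circuit m (insert w (B.erase j)) v)
  rw [linearCombination_circuit hB'] at h
  have hz : coef m B 0 = 0 := hB.coefₗ.map_zero
  rw [hz, dotProduct_zero, zero_add] at h
  rw [redCost, h]
  by_cases hv : v ∈ B
  · rw [redCost_eq_zero hB u hv]
    refine Finset.sum_eq_zero fun k hk => ?_
    have hkB : k ∉ B := by simpa using hk
    by_cases hkw : k = w
    · simp [hkw, h0]
    · rw [circuit_of_notMem hB' (j := k) (by simp [hkw, hkB]) (by rintro rfl; exact hkB hv), zero_mul]
  · by_cases hvw : v = w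
    · rw [hvw, h0, circuit_eq_zero hB' (by simp)]
      simp
    rw [Finset.sum_eq_single v]
    · rw [circuit_self hB' (by simp [hvw, hv]), one_mul]
    · intro k hk hkv
      have hkB : k ∉ B := by simpa using hk
      by_cases hkw : k = w
      · simp [hkw, h0]
      · rw [circuit_of_notMem hB' (by simp [hkw, hkB]) hkv, zero_mul]
    · simp [hv]

end
end Simplex

section Pivot

variable {ι V : Type*} [Fintype ι] [DecidableEq ι] [AddCommGroup V] [Module ℝ V]

/-- Every expansion of `γ` with nonnegative coefficients involves a spanning subfamily. -/
def IsGeneric (m : ι → V) (γ : V) : Prop :=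
  ∀ a : ι → ℝ, (∀ j, 0 ≤ a j) → Fintype.linearCombination ℝ m a = γ →
    ∀ x, ∃ b : ι → ℝ, (∀ j, a j = 0 → b j = 0) ∧ Fintype.linearCombination ℝ m b = x

/-- `B` is a basis and `γ` lies in the interior of its cone. -/
def Feasible (m : ι → V) (γ : V) (B : Finset ι) : Prop :=
  IsColBasis m B ∧ ∀ j ∈ B, 0 < coef m B γ j

/-- All vectors of the family lie in an open half space. -/
def IsPointed (m : ι → V) : Prop := ∃ ξ : V →ₗ[ℝ] ℝ, ∀ j, 0 < ξ (m j)

variable {m : ι → V} {γ : V} {B : Finset ι}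

theorem IsGeneric.pos (hγ : IsGeneric m γ) (hB : IsColBasis m B) {a : ι → ℝ} (ha : ∀ j, 0 ≤ a j)
    (haB : ∀ j ∉ B, a j = 0) (haγ : Fintype.linearCombination ℝ m a = γ) {j : ι} (hj : j ∈ B) :
    0 < a j := by
  refine lt_of_le_of_ne (ha j) fun h0 => ?_
  obtain ⟨b, hb, hbx⟩ := hγ a ha haγ (m j)
  have h := hB.eq_coef (fun k hk => hb k (haB k hk)) hbx
  rw [hB.coef_self hj] at h
  have h1 := hb j h0.symm
  rw [h] at h1
  simp at h1

theorem IsGeneric.feasible (hγ : IsGeneric m γ) (hB : IsColBasis m B) {a : ι → ℝ}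
    (ha : ∀ j, 0 ≤ a j) (haB : ∀ j ∉ B, a j = 0) (haγ : Fintype.linearCombination ℝ m a = γ) :
    Feasible m γ B :=
  ⟨hB, fun _ hj => hB.eq_coef haB haγ ▸ hγ.pos hB ha haB haγ hj⟩

theorem Feasible.coef_nonneg (hB : Feasible m γ B) (j : ι) : 0 ≤ coef m B γ j := by
  by_cases hj : j ∈ B
  · exact (hB.2 j hj).le
  · exact (hB.1.coef_of_notMem γ hj).ge

/-- In a pointed family a nonzero relation has a negative coefficient. -/
theorem IsPointed.exists_neg (hm : IsPointed m) {c : ι → ℝ}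
    (hc : Fintype.linearCombination ℝ m c = 0) {w : ι} (hw : 0 < c w) : ∃ j, c j < 0 := by
  obtain ⟨ξ, hξ⟩ := hm
  by_contra! h
  have h1 : ∑ j, c j * ξ (m j) = 0 := by
    have := congrArg ξ hc
    simpa [Fintype.linearCombination_apply] using this
  have h2 : 0 < ∑ j, c j * ξ (m j) :=
    Finset.sum_pos' (fun j _ => mul_nonneg (h j) (hξ j).le)
      ⟨w, Finset.mem_univ _, mul_pos hw (hξ w)⟩
  exact h2.ne' h1

/-- Moving a positive vector along a direction with a negative entry until a coordinate
vanishes. -/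
theorem exists_ratio_test {a c : ι → ℝ} (ha : ∀ j, 0 ≤ a j) (hac : ∀ j, c j < 0 → 0 < a j)
    (hc : ∃ j, c j < 0) :
    ∃ t > (0 : ℝ), ∃ j, c j < 0 ∧ (∀ k, 0 ≤ (a + t • c) k) ∧ (a + t • c) j = 0 := by
  obtain ⟨j₀, hj₀⟩ := hc
  obtain ⟨j, hj, hmin⟩ := Finset.exists_min_image (Finset.univ.filter fun j => c j < 0)
    (fun j => a j / -c j) ⟨j₀, by simpa using hj₀⟩
  have hj : c j < 0 := by simpa using hj
  refine ⟨a j / -c j, div_pos (hac j hj) (by linarith), j, hj, fun k => ?_, ?_⟩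
  · by_cases hk : c k < 0
    · have h := hmin k (by simpa using hk)
      rw [le_div_iff₀ (by linarith)] at h
      simp only [Pi.add_apply, Pi.smul_apply, smul_eq_mul]
      linarith
    · have : 0 ≤ a j / -c j := (div_pos (hac j hj) (by linarith)).le
      exact add_nonneg (ha k) (mul_nonneg this (not_lt.1 hk))
  · simp only [Pi.add_apply, Pi.smul_apply, smul_eq_mul]
    field_simp [hj.ne]
    simp

theorem Feasible.exists_pivot (hm : IsPointed m) (hγ : IsGeneric m γ) (hB : Feasible m γ B) {w : ι}
    (hw : w ∉ B) :
    ∃ j ∈ B, circuit m B w j < 0 ∧ Feasible m γ (insert w (B.erase j)) ∧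
      ∃ t > (0 : ℝ), coef m (insert w (B.erase j)) γ = coef m B γ + t • circuit m B w := by
  have hneg : ∀ j, circuit m B w j < 0 → j ∈ B := by
    intro j hj
    by_contra hjB
    by_cases hjw : j = w
    · subst hjw
      rw [circuit_self hB.1 hw] at hj
      linarith
    · rw [circuit_of_notMem hB.1 hjB hjw] at hj
      exact lt_irrefl _ hj
  obtain ⟨t, ht, j, hj, hnn, h0⟩ := exists_ratio_test hB.coef_nonneg
    (fun j hj => hB.2 j (hneg j hj))
    (hm.exists_neg (linearCombination_circuit hB.1 w) (w := w)
      (by rw [circuit_self hB.1 hw]; exact one_pos))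
  have hB' := hB.1.exchange hw (hneg j hj) hj.ne
  have hsupp : ∀ k ∉ insert w (B.erase j), (coef m B γ + t • circuit m B w) k = 0 := by
    intro k hk
    rw [Finset.mem_insert, Finset.mem_erase, not_or, not_and] at hk
    by_cases hkj : k = j
    · rw [hkj, h0]
    · simp [hB.1.coef_of_notMem _ (hk.2 hkj), circuit_of_notMem hB.1 (hk.2 hkj) hk.1]
  have hsum : Fintype.linearCombination ℝ m (coef m B γ + t • circuit m B w) = γ := by
    rw [map_add, map_smul, linearCombination_circuit hB.1, hB.1.linearCombination_coef]
    simp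
  exact ⟨j, hneg j hj, hj, hγ.feasible hB' hnn hsupp hsum, t, ht, (hB'.eq_coef hsupp hsum).symm⟩

theorem Feasible.pivot_unique (hB : Feasible m γ B) {w j k : ι} (hw : w ∉ B)
    (hj : j ∈ B) (hk : k ∈ B) (hcj : circuit m B w j < 0) (hck : circuit m B w k < 0)
    (hBj : Feasible m γ (insert w (B.erase j))) (hBk : Feasible m γ (insert w (B.erase k))) :
    j = k := by
  by_contra hjk
  have key : ∀ {l}, l ∈ B → Feasible m γ (insert w (B.erase l)) →
      ∀ i, coef m B γ i = coef m (insert w (B.erase l)) γ i -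
        coef m (insert w (B.erase l)) γ w * circuit m B w i := by
    intro l hl hBl i
    refine (congrFun (hB.1.eq_coef (a := coef m (insert w (B.erase l)) γ -
        coef m (insert w (B.erase l)) γ w • circuit m B w) (fun i hi => ?_) ?_) i).symm
    · by_cases hiw : i = w
      · subst hiw
        simp [circuit_self hB.1 hw]
      · simp [circuit_of_notMem hB.1 hi hiw,
          hBl.1.coef_of_notMem γ (j := i) (by simp [hiw, hi])]
    · rw [map_sub, map_smul, linearCombination_circuit hB.1, hBl.1.linearCombination_coef]
      simp
  have hwj : w ≠ j := fun h => hw (h ▸ hj)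
  have hwk : w ≠ k := fun h => hw (h ▸ hk)
  have h1 := (key hj hBj j).symm.trans (key hk hBk j)
  have h2 := (key hj hBj k).symm.trans (key hk hBk k)
  rw [hBj.1.coef_of_notMem γ (j := j) (by simp [hwj.symm])] at h1
  rw [hBk.1.coef_of_notMem γ (j := k) (by simp [hwk.symm])] at h2
  have h3 := hBk.2 j (by simp [hjk, hj])
  have h4 := hBj.2 k (by simp [Ne.symm hjk, hk])
  nlinarith

/-- A generic point of the cone lies in the cone of some basis. -/
theorem exists_feasible (hm : IsPointed m) (hγ : IsGeneric m γ)
    (h : ∃ a : ι → ℝ, (∀ j, 0 ≤ a j) ∧ Fintype.linearCombination ℝ m a = γ) :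
    ∃ B, Feasible m γ B := by
  let p : ℕ → Prop := fun N => ∃ a : ι → ℝ, (∀ j, 0 ≤ a j) ∧
    Fintype.linearCombination ℝ m a = γ ∧ (Finset.univ.filter fun j => a j ≠ 0).card = N
  have hp : ∃ N, p N := by
    obtain ⟨a, ha, haγ⟩ := h
    exact ⟨_, a, ha, haγ, rfl⟩
  obtain ⟨a, ha, haγ, hN⟩ := Nat.find_spec hp
  have hmem : ∀ j, j ∉ (Finset.univ.filter fun j => a j ≠ 0) ↔ a j = 0 := by simp
  have hindep : ∀ c : ι → ℝ, (∀ j, a j = 0 → c j = 0) → Fintype.linearCombination ℝ m c = 0 →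
      ∀ j, ¬ 0 < c j := by
    intro c hca hc w hw
    obtain ⟨t, -, j, hj, hnn, h0⟩ := exists_ratio_test ha
      (fun j hj => lt_of_le_of_ne (ha j) fun h => hj.ne (hca j h.symm)) (hm.exists_neg hc hw)
    refine Nat.find_min hp (m := (Finset.univ.filter fun k => (a + t • c) k ≠ 0).card) ?_
      ⟨a + t • c, hnn, by rw [map_add, map_smul, hc, haγ]; simp, rfl⟩
    rw [← hN]
    refine Finset.card_lt_card ⟨fun k hk => ?_, fun hsub => ?_⟩
    · simp only [Finset.mem_filter, Finset.mem_univ, true_and] at hk ⊢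
      intro hk0
      exact hk (by simp [hk0, hca k hk0])
    · have : j ∈ Finset.univ.filter fun k => (a + t • c) k ≠ 0 :=
        hsub (by simpa using fun h => hj.ne (hca j h))
      simp only [Finset.mem_filter] at this
      exact this.2 h0
  have hB : IsColBasis m (Finset.univ.filter fun j => a j ≠ 0) := by
    intro x
    obtain ⟨b, hb, hbx⟩ := hγ a ha haγ x
    refine ⟨b, ⟨fun j hj => hb j ((hmem j).1 hj), hbx⟩, ?_⟩
    rintro b' ⟨hb', hbx'⟩
    have h1 := hindep (b' - b)
      (fun j hj => by simp [hb j hj, hb' j ((hmem j).2 hj)]) (by rw [map_sub, hbx, hbx', sub_self])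
    have h2 := hindep (b - b')
      (fun j hj => by simp [hb j hj, hb' j ((hmem j).2 hj)]) (by rw [map_sub, hbx, hbx', sub_self])
    ext j
    have h1 := h1 j
    have h2 := h2 j
    simp only [Pi.sub_apply] at h1 h2
    linarith
  exact ⟨_, hγ.feasible hB ha (fun j hj => (hmem j).1 hj) haγ⟩

end Pivot

section SignedSum

variable {ι V : Type*} [Fintype ι] [DecidableEq ι] [AddCommGroup V] [Module ℝ V]

/-- For `r < 0` the indicator of `0 ≤ k`, for `r > 0` minus the indicator of `k < 0`, and the
average of the two for `r = 0`. -/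
noncomputable def flipInd (r k : ℝ) : ℝ :=
  (if 0 ≤ k then 1 else 0) - 1 / 2 - (SignType.sign r : ℝ) / 2

theorem flipInd_of_neg {r : ℝ} (hr : r < 0) (k : ℝ) : flipInd r k = if 0 ≤ k then 1 else 0 := by
  rw [flipInd, sign_neg hr]
  simp only [SignType.coe_neg, SignType.coe_one]
  ring

theorem flipInd_of_pos {r : ℝ} (hr : 0 < r) (k : ℝ) : flipInd r k = if 0 ≤ k then 0 else -1 := by
  rw [flipInd, sign_pos hr]
  split_ifs <;> norm_num

/-- The signed sum over feasible bases of the indicators of the flipped cones at the vertices. -/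
noncomputable def flipSum (m : ι → V) (γ : V) (u β : ι → ℝ) : ℝ :=
  ∑ B with Feasible m γ B, ∏ w ∈ Bᶜ, flipInd (redCost m u B w) (β w)

variable {m : ι → V} {γ : V}

theorem redCost_add_smul (m : ι → V) (u v : ι → ℝ) (t : ℝ) (B : Finset ι) (w : ι) :
    redCost m (u + t • v) B w = redCost m u B w + t * redCost m v B w := by
  simp [redCost, add_dotProduct]

/-- No reduced cost vanishes identically, and no two vanish simultaneously for the same basis,
along the line `u + t • v`. -/
structure IsGenericLine (m : ι → V) (u v : ι → ℝ) : Prop where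
  ne_zero : ∀ B w, IsColBasis m B → w ∉ B → redCost m u B w ≠ 0
  ne_ratio : ∀ B w w', IsColBasis m B → w ∉ B → w' ∉ B → w ≠ w' → redCost m v B w ≠ 0 →
    redCost m v B w' ≠ 0 →
      redCost m u B w * redCost m v B w' ≠ redCost m u B w' * redCost m v B w

theorem IsGenericLine.unique {u v : ι → ℝ} (h : IsGenericLine m u v) {B : Finset ι}
    (hB : IsColBasis m B) {w w' : ι} (hw : w ∉ B) (hw' : w' ∉ B) {t : ℝ}
    (h0 : redCost m (u + t • v) B w = 0) (h0' : redCost m (u + t • v) B w' = 0) : w = w' := by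
  by_contra hne
  rw [redCost_add_smul] at h0 h0'
  have h1 : redCost m v B w ≠ 0 := fun h1 => h.ne_zero B w hB hw (by simpa [h1] using h0)
  have h1' : redCost m v B w' ≠ 0 := fun h1 => h.ne_zero B w' hB hw' (by simpa [h1] using h0')
  refine h.ne_ratio B w w' hB hw hw' hne h1 h1' ?_
  linear_combination redCost m v B w' * h0 - redCost m v B w * h0'

theorem prod_flipInd_of_sign_eq {u u' β : ι → ℝ} {B : Finset ι} {W : Finset ι}
    (h : ∀ w ∈ W, SignType.sign (redCost m u B w) = SignType.sign (redCost m u' B w)) :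
    ∏ w ∈ W, flipInd (redCost m u B w) (β w) = ∏ w ∈ W, flipInd (redCost m u' B w) (β w) :=
  Finset.prod_congr rfl fun w hw => by rw [flipInd, flipInd, h w hw]

theorem flipSum_eq_of_sign_eq (hm : IsPointed m) (hγ : IsGeneric m γ) {u u₀ : ι → ℝ} (β : ι → ℝ)
    (huniq : ∀ B, IsColBasis m B → ∀ w ∉ B, ∀ w' ∉ B, redCost m u₀ B w = 0 →
      redCost m u₀ B w' = 0 → w = w')
    (hsign : ∀ B w, redCost m u₀ B w ≠ 0 →
      SignType.sign (redCost m u B w) = SignType.sign (redCost m u₀ B w)) :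
    flipSum m γ u β = flipSum m γ u₀ β := by
  rw [← sub_eq_zero, flipSum, flipSum, ← Finset.sum_sub_distrib]
  set f : Finset ι → ℝ := fun B => ∏ w ∈ Bᶜ, flipInd (redCost m u B w) (β w) -
    ∏ w ∈ Bᶜ, flipInd (redCost m u₀ B w) (β w) with hf
  have hnd : ∀ B, (¬ ∃ w ∉ B, redCost m u₀ B w = 0) → f B = 0 := by
    intro B hB
    push Not at hB
    rw [hf]
    simp only
    rw [prod_flipInd_of_sign_eq fun w hw => hsign B w (hB w (by simpa using hw)), sub_self]
  have hdeg : ∀ B w, IsColBasis m B → w ∉ B → redCost m u₀ B w = 0 →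
      f B = -((SignType.sign (redCost m u B w) : ℝ) / 2 *
        ∏ v ∈ (insert w B)ᶜ, flipInd (redCost m u₀ B v) (β v)) := by
    intro B w hB hw h0
    have hins : Bᶜ = insert w (insert w B)ᶜ := by
      ext k
      by_cases hk : k = w
      · simp [hk, hw]
      · simp [hk]
    have hnot : w ∉ (insert w B)ᶜ := by simp
    rw [hf]
    simp only
    rw [hins, Finset.prod_insert hnot, Finset.prod_insert hnot,
      prod_flipInd_of_sign_eq (u := u) (u' := u₀) (W := (insert w B)ᶜ), h0]
    · simp only [flipInd, sign_zero, SignType.coe_zero]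
      ring
    · intro v hv
      simp only [Finset.mem_compl, Finset.mem_insert, not_or] at hv
      exact hsign B v fun hv0 => hv.1 (huniq B hB v hv.2 w hw hv0 h0)
  rcases isEmpty_or_nonempty ι with hι | hι
  · exact Finset.sum_eq_zero fun B _ => hnd B fun ⟨w, _⟩ => isEmptyElim w
  rw [← Finset.sum_filter_of_ne (p := fun B => ∃ w ∉ B, redCost m u₀ B w = 0)
    (fun B _ hne => by by_contra h; exact hne (hnd B h))]
  rw [Finset.filter_filter]
  set D := Finset.univ.filter fun B => Feasible m γ B ∧ ∃ w ∉ B, redCost m u₀ B w = 0 with hD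
  have hex : ∀ B ∈ D,
      ∃ w j, w ∉ B ∧ redCost m u₀ B w = 0 ∧ j ∈ B ∧ circuit m B w j < 0 ∧
        Feasible m γ (insert w (B.erase j)) := by
    intro B hB
    simp only [hD, Finset.mem_filter, Finset.mem_univ, true_and] at hB
    obtain ⟨hF, w, hw, h0⟩ := hB
    obtain ⟨j, hj, hc, hF', -⟩ := hF.exists_pivot hm hγ hw
    exact ⟨w, j, hw, h0, hj, hc, hF'⟩
  choose! e l hw h0 hl hc hF' using hex
  have hF : ∀ B ∈ D, Feasible m γ B :=
    fun B hB => (Finset.mem_filter.1 hB).2.1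
  have hel : ∀ B ∈ D, e B ≠ l B :=
    fun B hB h => hw B hB (h ▸ hl B hB)
  have hl' : ∀ B ∈ D,
      l B ∉ insert (e B) (B.erase (l B)) := fun B hB => by simp [(hel B hB).symm]
  have hr0 : ∀ B ∈ D,
      redCost m u₀ (insert (e B) (B.erase (l B))) (l B) = 0 := by
    intro B hB
    rw [redCost_exchange_self (hF B hB).1 u₀ (hw B hB) (hl B hB) (hc B hB).ne, h0 B hB, mul_zero]
  have hmem : ∀ B (hB : B ∈ D),
      insert (e B) (B.erase (l B)) ∈ D := fun B hB =>
    Finset.mem_filter.2 ⟨Finset.mem_univ _, hF' B hB, l B, hl' B hB, hr0 B hB⟩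
  have hback : ∀ B ∈ D,
      insert (l B) ((insert (e B) (B.erase (l B))).erase (e B)) = B := by
    intro B hB
    rw [Finset.erase_insert (by simp [hw B hB]), Finset.insert_erase (hl B hB)]
  refine Finset.sum_involution (fun B _ => insert (e B) (B.erase (l B))) ?_ ?_ hmem ?_
  · intro B hB
    have hb := (hF B hB).1
    change f B + f (insert (e B) (B.erase (l B))) = 0
    rw [hdeg B (e B) hb (hw B hB) (h0 B hB),
      hdeg _ (l B) (hF' B hB).1 (hl' B hB) (hr0 B hB),
      redCost_exchange_self hb u (hw B hB) (hl B hB) (hc B hB).ne, sign_mul,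
      sign_neg (inv_lt_zero.2 (hc B hB)), SignType.coe_mul]
    have hI : insert (l B) (insert (e B) (B.erase (l B))) = insert (e B) B := by
      rw [Finset.insert_comm, Finset.insert_erase (hl B hB)]
    rw [hI]
    simp only [redCost_exchange hb u₀ (hw B hB) (hl B hB) (hc B hB).ne (h0 B hB),
      SignType.coe_neg, SignType.coe_one]
    ring
  · intro B hB _ h
    exact hl' B hB (by rw [h]; exact hl B hB)
  · intro B hB
    set B' := insert (e B) (B.erase (l B)) with hB'
    have hm' := hmem B hB
    rw [← hB'] at hm'
    have he : e B' = l B :=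
      huniq B' (hF' B hB).1 _ (hw B' hm') _ (hl' B hB) (h0 B' hm') (hr0 B hB)
    have hcir : circuit m B' (l B) (e B) < 0 := by
      rw [hB', circuit_exchange (hF B hB).1 (hw B hB) (hl B hB) (hc B hB).ne]
      simpa [circuit_self (hF B hB).1 (hw B hB)] using hc B hB
    have hlB : l B' = e B := by
      refine (hF' B hB).pivot_unique (hl' B hB) (hl B' hm') (by simp) ?_ hcir ?_ ?_
      · have := hc B' hm'
        rwa [he] at this
      · have := hF' B' hm'
        rwa [he] at this
      · rw [hback B hB]
        exact hF B hB
    rw [he, hlB, hback B hB]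

theorem isLocallyConstant_flipSum (hm : IsPointed m) (hγ : IsGeneric m γ) {u v : ι → ℝ}
    (h : IsGenericLine m u v) (β : ι → ℝ) :
    IsLocallyConstant fun t : ℝ => flipSum m γ (u + t • v) β := by
  rw [IsLocallyConstant.iff_eventually_eq]
  intro t₀
  have hev : ∀ᶠ t in nhds t₀, ∀ B w, redCost m (u + t₀ • v) B w ≠ 0 →
      SignType.sign (redCost m (u + t • v) B w) =
        SignType.sign (redCost m (u + t₀ • v) B w) := by
    rw [Filter.eventually_all]
    intro B
    rw [Filter.eventually_all]
    intro w
    by_cases h0 : redCost m (u + t₀ • v) B w = 0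
    · exact Filter.Eventually.of_forall fun t ht => absurd h0 ht
    · have hcont : ContinuousAt (fun t : ℝ => SignType.sign (redCost m (u + t • v) B w)) t₀ := by
        refine ContinuousAt.comp (g := SignType.sign) (continuousAt_sign_of_ne_zero h0) ?_
        simp only [redCost_add_smul]
        fun_prop
      have := hcont.eventually (isOpen_discrete {_}|>.mem_nhds (Set.mem_singleton _))
      filter_upwards [this] with t ht _ using ht
  filter_upwards [hev] with t ht
  exact flipSum_eq_of_sign_eq hm hγ β
    (fun B hB w hw w' hw' h0 h0' => h.unique hB hw hw' h0 h0') ht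

/-- If a coordinate of `β` is negative, lowering its cost kills every summand. -/
theorem flipSum_eq_zero (hm : IsPointed m) (hγ : IsGeneric m γ) {u β : ι → ℝ} {j : ι}
    (h : IsGenericLine m u (-Pi.single j 1)) (hj : β j < 0)
    (hβ : ∀ B, Feasible m γ B → 0 ≤ coef m B (Fintype.linearCombination ℝ m β) j) :
    flipSum m γ u β = 0 := by
  have hconst := (isLocallyConstant_flipSum hm hγ h β).apply_eq_of_preconnectedSpace
  have hr : ∀ t B w, redCost m (u + t • (-Pi.single j 1)) B w =
      redCost m u B w - t * circuit m B w j := by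
    intro t B w
    rw [redCost_add_smul]
    simp [redCost, sub_eq_add_neg]
  obtain ⟨T, hT⟩ : ∃ T : ℝ, ∀ B w, circuit m B w j ≠ 0 →
      SignType.sign (redCost m (u + T • (-Pi.single j 1)) B w) =
        -SignType.sign (circuit m B w j) := by
    have hev : ∀ᶠ t : ℝ in Filter.atTop, ∀ B w, circuit m B w j ≠ 0 →
        SignType.sign (redCost m (u + t • (-Pi.single j 1)) B w) =
          -SignType.sign (circuit m B w j) := by
      rw [Filter.eventually_all]
      intro B
      rw [Filter.eventually_all]
      intro w
      simp only [hr]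
      filter_upwards [Filter.eventually_gt_atTop (redCost m u B w / circuit m B w j)] with t ht hne
      rcases lt_or_gt_of_ne hne with hlt | hgt
      · rw [div_lt_iff_of_neg hlt] at ht
        rw [sign_neg hlt, sign_pos (by linarith)]
        rfl
      · rw [div_lt_iff₀ hgt] at ht
        rw [sign_pos hgt, sign_neg (by linarith)]
    exact hev.exists
  have h0 := hconst 0 T
  simp only [zero_smul, add_zero] at h0
  rw [h0, flipSum]
  refine Finset.sum_eq_zero fun B hB => ?_
  have hF : Feasible m γ B := (Finset.mem_filter.1 hB).2
  by_contra hne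
  rw [← ne_eq, Finset.prod_ne_zero_iff] at hne
  have hs : ∀ w ∉ B, 0 ≤ circuit m B w j * β w ∧ (circuit m B w j ≠ 0 → 0 < circuit m B w j →
      0 ≤ β w) := by
    intro w hw
    have h1 := hne w (by simpa using hw)
    by_cases hc : circuit m B w j = 0
    · simp [hc]
    have hs := hT B w hc
    rcases lt_or_gt_of_ne hc with hlt | hgt
    · rw [sign_neg hlt, neg_neg, sign_eq_one_iff] at hs
      rw [flipInd_of_pos hs] at h1
      have : β w < 0 := by
        by_contra hb
        exact h1 (if_pos (not_lt.1 hb))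
      exact ⟨by nlinarith, fun _ h => by linarith⟩
    · rw [sign_pos hgt, sign_eq_neg_one_iff] at hs
      rw [flipInd_of_neg hs] at h1
      have : 0 ≤ β w := by
        by_contra hb
        exact h1 (if_neg hb)
      exact ⟨by positivity, fun _ _ => this⟩
  by_cases hjB : j ∈ B
  · have h2 := hβ B hF
    rw [hF.1.coef_linearCombination, Finset.sum_apply] at h2
    have h3 : ∑ w, (β w • coef m B (m w)) j = β j - ∑ w, circuit m B w j * β w := by
      simp [circuit, mul_sub, Finset.sum_sub_distrib, Pi.single_apply, mul_comm]
    rw [h3] at h2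
    have h4 : 0 ≤ ∑ w, circuit m B w j * β w := by
      refine Finset.sum_nonneg fun w _ => ?_
      by_cases hw : w ∈ B
      · simp [circuit_eq_zero hF.1 hw]
      · exact (hs w hw).1
    linarith
  · have h1 := (hs j hjB).2
    rw [circuit_self hF.1 hjB] at h1
    linarith [h1 one_ne_zero one_pos]

/-- For nonnegative `β` only the optimal basis contributes. -/
theorem flipSum_eq_one (hm : IsPointed m) (hγ : IsGeneric m γ) {u β : ι → ℝ}
    (h : ∀ B w, IsColBasis m B → w ∉ B → redCost m u B w ≠ 0) (hβ : ∀ j, 0 ≤ β j)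
    (hne : ∃ B, Feasible m γ B) :
    flipSum m γ u β = 1 := by
  obtain ⟨B₁, hB₁⟩ := hne
  obtain ⟨B, hB, hmax⟩ := Finset.exists_max_image (Finset.univ.filter fun B => Feasible m γ B)
    (fun B => u ⬝ᵥ coef m B γ) ⟨B₁, by simpa using hB₁⟩
  have hF : Feasible m γ B := by simpa using hB
  have hopt : ∀ w ∉ B, redCost m u B w < 0 := by
    intro w hw
    refine lt_of_le_of_ne (not_lt.1 fun hpos => ?_) (h B w hF.1 hw)
    obtain ⟨j, -, -, hF', t, ht, hcoef⟩ := hF.exists_pivot hm hγ hw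
    have h1 := hmax _ (Finset.mem_filter.2 ⟨Finset.mem_univ _, hF'⟩)
    rw [hcoef, dotProduct_add, dotProduct_smul, smul_eq_mul] at h1
    have h2 : 0 < t * (u ⬝ᵥ circuit m B w) := mul_pos ht hpos
    linarith
  have hval : ∀ B' B'', Feasible m γ B' → Feasible m γ B'' → (∀ w ∉ B', redCost m u B' w < 0) →
      (u ⬝ᵥ coef m B'' γ ≤ u ⬝ᵥ coef m B' γ ∧
        (u ⬝ᵥ coef m B' γ ≤ u ⬝ᵥ coef m B'' γ → B'' ⊆ B')) := by
    intro B' B'' hF' hF'' hopt'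
    have h1 := dotProduct_eq_add_sum_redCost hF'.1 u (coef m B'' γ)
    rw [hF''.1.linearCombination_coef] at h1
    have h2 : ∀ w ∈ B'ᶜ, coef m B'' γ w * redCost m u B' w ≤ 0 := fun w hw =>
      mul_nonpos_of_nonneg_of_nonpos (hF''.coef_nonneg w) (hopt' w (by simpa using hw)).le
    have h3 := Finset.sum_nonpos h2
    refine ⟨by linarith, fun h4 w hw => ?_⟩
    by_contra hwB
    have h5 : ∑ w ∈ B'ᶜ, coef m B'' γ w * redCost m u B' w < 0 :=
      Finset.sum_neg' h2 ⟨w, by simpa using hwB,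
        mul_neg_of_pos_of_neg (hF''.2 w hw) (hopt' w hwB)⟩
    linarith
  rw [flipSum, Finset.sum_eq_single B]
  · refine Finset.prod_eq_one fun w hw => ?_
    rw [flipInd_of_neg (hopt w (by simpa using hw)), if_pos (hβ w)]
  · intro B' hB' hBB'
    have hF' : Feasible m γ B' := by simpa using hB'
    by_contra hprod
    rw [← ne_eq, Finset.prod_ne_zero_iff] at hprod
    have hopt' : ∀ w ∉ B', redCost m u B' w < 0 := by
      intro w hw
      refine lt_of_le_of_ne (not_lt.1 fun hpos => ?_) (h B' w hF'.1 hw)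
      exact hprod w (by simpa using hw) (by rw [flipInd_of_pos hpos, if_pos (hβ w)])
    have h1 := hval B B' hF hF' hopt
    have h2 := hval B' B hF' hF hopt'
    exact hBB' (Finset.Subset.antisymm (h1.2 h2.1) (h2.2 h1.1))
  · intro hB'
    exact absurd hB hB'

/-- A cost vector in general position. -/
theorem exists_generic_cost (m : ι → V) :
    ∃ u : ι → ℝ, ∀ j : ι, IsGenericLine m u (-Pi.single j 1) := by
  let vec : (Finset ι × ι) ⊕ (ι × Finset ι × ι × ι) → ι → ℝ :=
    Sum.elim (fun p => circuit m p.1 p.2) fun p =>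
      circuit m p.2.1 p.2.2.2 p.1 • circuit m p.2.1 p.2.2.1 -
        circuit m p.2.1 p.2.2.1 p.1 • circuit m p.2.1 p.2.2.2
  obtain ⟨f, hf⟩ := Module.exists_dual_forall_apply_ne_zero (K := ℝ)
    (fun x : {x // vec x ≠ 0} => vec x.1) fun x => x.2
  have hdot : ∀ a : ι → ℝ, (fun i => f (Pi.single i 1)) ⬝ᵥ a = f a := by
    intro a
    conv_rhs => rw [pi_eq_sum_univ' a, map_sum]
    simp [dotProduct, mul_comm]
  have hr : ∀ j B w, redCost m (-Pi.single j 1) B w = -circuit m B w j := by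
    intro j B w
    simp [redCost]
  refine ⟨fun i => f (Pi.single i 1), fun j => ⟨fun B w hB hw => ?_, ?_⟩⟩
  · rw [redCost, hdot]
    refine hf ⟨Sum.inl (B, w), fun h0 => ?_⟩
    have := congrFun h0 w
    simp [vec, circuit_self hB hw] at this
  · intro B w w' hB hw hw' hne h1 h2 h
    rw [hr] at h1 h2
    refine hf ⟨Sum.inr (j, B, w, w'), fun h0 => ?_⟩ ?_
    · have := congrFun h0 w
      simp only [vec, Sum.elim_inr, Pi.sub_apply, Pi.smul_apply, circuit_self hB hw,
        circuit_of_notMem hB hw hne, smul_eq_mul, mul_zero, mul_one, sub_zero] at this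
      exact h2 (by rw [this]; simp)
    · rw [hr, hr, redCost, redCost, hdot, hdot] at h
      simp only [vec, Sum.elim_inr, map_sub, map_smul, smul_eq_mul]
      linarith

end SignedSum

section Series

theorem hasSum_prod_fin {κ : Type*} {d : ℕ} (f : Fin d → κ → ℂ) (a : Fin d → ℂ)
    (h : ∀ i, HasSum (f i) (a i)) : HasSum (fun k : Fin d → κ => ∏ i, f i (k i)) (∏ i, a i) := by
  induction d with
  | zero => simp
  | succ d ih =>
    have h1 := ih (fun i => f i.succ) (fun i => a i.succ) fun i => h _
    have h2 : HasSum (fun x : κ × (Fin d → κ) => f 0 x.1 * ∏ i, f (Fin.succ i) (x.2 i))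
        (a 0 * ∏ i, a (Fin.succ i)) := by
      have hs := summable_mul_of_summable_norm (f := f 0)
        (g := fun k : Fin d → κ => ∏ i, f (Fin.succ i) (k i)) (h 0).summable.norm h1.summable.norm
      have ht := tsum_mul_tsum_of_summable_norm (f := f 0)
        (g := fun k : Fin d → κ => ∏ i, f (Fin.succ i) (k i)) (h 0).summable.norm h1.summable.norm
      rw [(h 0).tsum_eq, h1.tsum_eq] at ht
      rw [ht]
      exact hs.hasSum
    rw [Fin.prod_univ_succ, ← (Fin.consEquiv (fun _ : Fin (d + 1) => κ)).hasSum_iff]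
    convert h2 using 1
    funext ⟨x, k⟩
    simp [Fin.prod_univ_succ, Fin.consEquiv]

/-- A finite product of absolutely convergent series. -/
theorem hasSum_prod_pi {ι κ : Type*} [Fintype ι] (f : ι → κ → ℂ) (a : ι → ℂ)
    (h : ∀ i, HasSum (f i) (a i)) : HasSum (fun k : ι → κ => ∏ i, f i (k i)) (∏ i, a i) := by
  have e := (Fintype.equivFin ι).symm
  have := hasSum_prod_fin (fun i => f (e i)) (fun i => a (e i)) fun i => h _
  rw [e.prod_comp a] at this
  rw [← (e.arrowCongr (Equiv.refl κ)).hasSum_iff]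
  convert this using 1
  funext k
  simp only [Function.comp_apply]
  rw [← e.prod_comp]
  simp

theorem hasSum_flipInd_mul_zpow {r : ℝ} (hr : r ≠ 0) {q : ℂ} (hq : ‖q‖ = Real.exp r) :
    HasSum (fun k : ℤ => ((flipInd r (k : ℝ) : ℝ) : ℂ) * q ^ k) (1 - q)⁻¹ := by
  have hq0 : q ≠ 0 := by
    rw [← norm_pos_iff, hq]
    exact Real.exp_pos r
  rcases lt_or_gt_of_ne hr with hr | hr
  · have h := hasSum_geometric_of_norm_lt_one (ξ := q) (by rw [hq]; exact Real.exp_lt_one_iff.2 hr)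
    rw [← Nat.cast_injective (R := ℤ) |>.hasSum_iff]
    · refine (congrArg (fun g : ℕ → ℂ => HasSum g (1 - q)⁻¹) (funext fun k => ?_)).mpr h
      simp [flipInd_of_neg hr]
    · intro k hk
      have : ¬ 0 ≤ k := fun h0 => hk ⟨k.toNat, by simp [h0]⟩
      simp [flipInd_of_neg hr, this]
  · have h := (hasSum_geometric_of_norm_lt_one (ξ := q⁻¹)
      (by rw [norm_inv, hq, ← Real.exp_neg]; exact Real.exp_lt_one_iff.2 (by linarith))).mul_left (-q⁻¹)
    have h1 : 1 - q⁻¹ ≠ 0 := by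
      intro h0
      have : q = 1 := by
        rw [sub_eq_zero, eq_comm, inv_eq_one] at h0
        exact h0
      rw [this, norm_one, eq_comm, Real.exp_eq_one_iff] at hq
      exact hr.ne' hq
    have h2 : 1 - q ≠ 0 := by
      intro h0
      rw [← sub_eq_zero.1 h0] at h1
      simp at h1
    have hval : -q⁻¹ * (1 - q⁻¹)⁻¹ = (1 - q)⁻¹ := by
      rw [← mul_inv_eq_one₀ (inv_ne_zero h2), inv_inv]
      have h3 : q - 1 ≠ 0 := by
        rw [← neg_sub]
        exact neg_ne_zero.2 h2
      field_simp
      ring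
    rw [hval] at h
    have hinj : Function.Injective fun k : ℕ => -((k : ℤ) + 1) := by
      intro a b hab
      simpa using hab
    rw [← hinj.hasSum_iff]
    · refine (congrArg (fun g : ℕ → ℂ => HasSum g (1 - q)⁻¹) (funext fun k => ?_)).mpr h
      have : ¬ (0 : ℝ) ≤ ((-((k : ℤ) + 1) : ℤ) : ℝ) := by
        push_cast
        have : (0 : ℝ) ≤ k := Nat.cast_nonneg k
        linarith
      simp only [Function.comp_apply, flipInd_of_pos hr, if_neg this]
      rw [_root_.zpow_neg, ← Nat.cast_succ, zpow_natCast, pow_succ]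
      simp [mul_comm]
    · intro k hk
      have : 0 ≤ k := by
        by_contra h0
        exact hk ⟨(-k - 1).toNat, by simp only; omega⟩
      simp [flipInd_of_pos hr, this]

end Series

section Characters

theorem AddChar.map_sum_prod {G : Type*} [AddCommGroup G] (ψ : AddChar G ℂ) {ι : Type*}
    (t : Finset ι) (x : ι → G) : ψ (∑ j ∈ t, x j) = ∏ j ∈ t, ψ (x j) := by
  induction t using Finset.cons_induction with
  | empty => simp
  | cons a t ha ih => rw [Finset.sum_cons, Finset.prod_cons, ψ.map_add_eq_mul, ih]

theorem charP_zero {s : ℕ} (θ : Fin s → ℂ) : charP s θ 0 = 1 := by simp [_root_.charP]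

theorem charP_add {s : ℕ} {θ : Fin s → ℂ} (h : ∀ i, θ i ≠ 0) (x y : Fin s → ℤ) :
    charP s θ (x + y) = charP s θ x * charP s θ y := by
  simp only [_root_.charP, Pi.add_apply, ← Finset.prod_mul_distrib]
  exact Finset.prod_congr rfl fun i _ => zpow_add₀ (h i) _ _

/-- The additive character `y ↦ θ ^ y` of `ℤˢ`. -/
noncomputable def charPAddChar {s : ℕ} {θ : Fin s → ℂ} (h : ∀ i, θ i ≠ 0) :
    AddChar (Fin s → ℤ) ℂ where
  toFun := charP s θ
  map_zero_eq_one' := charP_zero θ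
  map_add_eq_mul' := charP_add h

theorem charP_neg {s : ℕ} {θ : Fin s → ℂ} (h : ∀ i, θ i ≠ 0) (x : Fin s → ℤ) :
    charP s θ (-x) = (charP s θ x)⁻¹ :=
  (charPAddChar h).map_neg_eq_inv x

theorem charP_zsmul {s : ℕ} {θ : Fin s → ℂ} (h : ∀ i, θ i ≠ 0) (k : ℤ) (x : Fin s → ℤ) :
    charP s θ (k • x) = charP s θ x ^ k :=
  (charPAddChar h).map_zsmul_eq_zpow k x

theorem charP_sum_zsmul {s : ℕ} {θ : Fin s → ℂ} (h : ∀ i, θ i ≠ 0) {ι : Type*} (t : Finset ι)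
    (k : ι → ℤ) (x : ι → Fin s → ℤ) :
    charP s θ (∑ j ∈ t, k j • x j) = ∏ j ∈ t, charP s θ (x j) ^ k j := by
  rw [show charP s θ = charPAddChar h from rfl, AddChar.map_sum_prod]
  exact Finset.prod_congr rfl fun j _ => charP_zsmul h _ _

theorem charP_mulVec {s : ℕ} {θ : Fin s → ℂ} (h : ∀ i, θ i ≠ 0) {ι : Type*} [Fintype ι]
    (N : Matrix (Fin s) ι ℤ) (k : ι → ℤ) :
    charP s θ (N *ᵥ k) = ∏ j, charP s θ (fun i => N i j) ^ k j := by
  rw [← charP_sum_zsmul h]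
  congr 1
  funext i
  simp [Matrix.mulVec, dotProduct, mul_comm]

theorem AddChar.eq_charP {s : ℕ} (ψ : AddChar (Fin s → ℤ) ℂ) (y : Fin s → ℤ) :
    charP s (fun i => ψ (Pi.single i 1)) y = ψ y := by
  have : y = ∑ i, y i • (Pi.single i 1 : Fin s → ℤ) := by
    funext i
    simp [Finset.sum_apply, Pi.single_apply]
  conv_rhs => rw [this]
  rw [AddChar.map_sum_prod]
  exact Finset.prod_congr rfl fun i _ => (ψ.map_zsmul_eq_zpow _ _).symm

/-- Orthogonality of the characters trivial on the lattice spanned by a nonsingular matrix. -/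
theorem exists_dual_group {s : ℕ} (N : Matrix (Fin s) (Fin s) ℤ) (hN : N.det ≠ 0) :
    ∃ T : Finset (Fin s → ℂ),
      (∀ θ, θ ∈ T ↔ (∀ i, θ i ≠ 0) ∧ ∀ j, charP s θ (fun i => N i j) = 1) ∧
      (∀ θ ∈ T, ∀ y, ‖charP s θ y‖ = 1) ∧
      ∀ y, ∑ θ ∈ T, charP s θ y = if ∃ k, N *ᵥ k = y then (N.det.natAbs : ℂ) else 0 := by
  have hinj : Function.Injective N.mulVecLin := by
    rw [Matrix.coe_mulVecLin]
    exact Matrix.mulVec_injective_of_det_ne_zero hN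
  set L := LinearMap.range N.mulVecLin with hL
  let e := LinearEquiv.ofInjective N.mulVecLin hinj
  have hcard : N.det.natAbs = Nat.card ((Fin s → ℤ) ⧸ L) := by
    rw [← Submodule.natAbs_det_equiv L e, ← LinearMap.det_toLin' N]
    rfl
  have hfin : Finite ((Fin s → ℤ) ⧸ L) :=
    Nat.finite_of_card_ne_zero (by rw [← hcard]; simpa using hN)
  let _ := Fintype.ofFinite ((Fin s → ℤ) ⧸ L)
  let lift : AddChar ((Fin s → ℤ) ⧸ L) ℂ → AddChar (Fin s → ℤ) ℂ := fun ψ =>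
    ψ.compAddMonoidHom L.mkQ.toAddMonoidHom
  have hlift : ∀ ψ y, lift ψ y = ψ (L.mkQ y) := fun _ _ => rfl
  let ev : AddChar ((Fin s → ℤ) ⧸ L) ℂ → Fin s → ℂ := fun ψ i => lift ψ (Pi.single i 1)
  have hev : ∀ ψ y, charP s (ev ψ) y = ψ (L.mkQ y) := fun ψ y => AddChar.eq_charP (lift ψ) y
  have hevinj : Function.Injective ev := by
    intro ψ φ h
    ext x
    obtain ⟨y, rfl⟩ := L.mkQ_surjective x
    rw [← hev, ← hev, h]
  refine ⟨Finset.univ.image ev, ?_, ?_, ?_⟩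
  · intro θ
    simp only [Finset.mem_image, Finset.mem_univ, true_and]
    constructor
    · rintro ⟨ψ, rfl⟩
      refine ⟨fun i => ?_, fun j => ?_⟩
      · rw [← norm_ne_zero_iff]
        change ‖ψ _‖ ≠ 0
        rw [ψ.norm_apply]
        exact one_ne_zero
      · rw [hev, (?_ : L.mkQ (fun i => N i j) = 0), AddChar.map_zero_eq_one]
        rw [Submodule.mkQ_apply, Submodule.Quotient.mk_eq_zero]
        exact ⟨Pi.single j 1, by funext i; simp⟩
    · rintro ⟨h0, h1⟩
      have hker : ∀ y ∈ L, charP s θ y = 1 := by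
        rintro _ ⟨k, rfl⟩
        rw [Matrix.mulVecLin_apply, charP_mulVec h0]
        simp [h1]
      have hwd : ∀ x y : Fin s → ℤ, L.mkQ x = L.mkQ y → charP s θ x = charP s θ y := by
        intro x y hxy
        rw [Submodule.mkQ_apply, Submodule.mkQ_apply, Submodule.Quotient.eq] at hxy
        rw [← sub_add_cancel x y, charP_add h0, hker _ hxy, one_mul]
      choose g hg using L.mkQ_surjective
      refine ⟨⟨fun x => charP s θ (g x), ?_, ?_⟩, ?_⟩
      · rw [hwd (g 0) 0 (by rw [hg, map_zero]), charP_zero]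
      · intro x y
        rw [← charP_add h0]
        exact hwd _ _ (by rw [hg, map_add, hg, hg])
      · funext i
        change charP s θ (g (L.mkQ (Pi.single i 1))) = θ i
        rw [hwd _ _ (hg _), _root_.charP, Finset.prod_eq_single i]
        · simp
        · intro b _ hb
          simp [hb]
        · simp
  · intro θ hθ y
    obtain ⟨ψ, -, rfl⟩ := Finset.mem_image.1 hθ
    rw [hev, ψ.norm_apply]
  · intro y
    rw [Finset.sum_image fun _ _ _ _ h => hevinj h]
    simp only [hev]
    rw [AddChar.sum_apply_eq_ite, hcard, Nat.card_eq_fintype_card]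
    congr 1
    rw [Submodule.mkQ_apply, Submodule.Quotient.mk_eq_zero]
    rfl

end Characters

section Bases

section
variable {ι V : Type*} [Fintype ι] [DecidableEq ι] [AddCommGroup V] [Module ℝ V]
  {m : ι → V} {B : Finset ι}

/-- Linear combinations supported on a finite set of indices. -/
theorem mem_span_image_iff_exists_linearCombination {x : V} :
    x ∈ Submodule.span ℝ (m '' (B : Set ι)) ↔
      ∃ a : ι → ℝ, (∀ j ∉ B, a j = 0) ∧ Fintype.linearCombination ℝ m a = x := by
  constructor
  · intro h
    rw [Submodule.mem_span_image_finset_iff_exists_fun'] at h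
    obtain ⟨c, hc⟩ := h
    refine ⟨fun j => if j ∈ B then c j else 0, fun j hj => if_neg hj, ?_⟩
    rw [Fintype.linearCombination_apply, ← hc]
    simp [ite_smul]
  · rintro ⟨a, ha, rfl⟩
    rw [Fintype.linearCombination_apply]
    refine Submodule.sum_mem _ fun j _ => ?_
    by_cases hj : j ∈ B
    · exact Submodule.smul_mem _ _ (Submodule.subset_span ⟨j, hj, rfl⟩)
    · simp [ha j hj]

theorem isColBasis_of_linearIndepOn (hli : LinearIndepOn ℝ m (B : Set ι))
    (hsp : Submodule.span ℝ (m '' (B : Set ι)) = ⊤) : IsColBasis m B := by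
  intro x
  obtain ⟨a, ha, hax⟩ := mem_span_image_iff_exists_linearCombination.1
    (hsp ▸ Submodule.mem_top : x ∈ Submodule.span ℝ (m '' (B : Set ι)))
  refine ⟨a, ⟨ha, hax⟩, ?_⟩
  rintro b ⟨hb, hbx⟩
  rw [linearIndepOn_finset_iff] at hli
  have h := hli (b - a) (by
    rw [← sub_eq_zero.2 (hbx.trans hax.symm), ← map_sub, Fintype.linearCombination_apply]
    refine Finset.sum_subset (Finset.subset_univ _) fun j _ hj => ?_
    simp [ha j hj, hb j hj])
  funext j
  by_cases hj : j ∈ B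
  · exact sub_eq_zero.1 (h j hj)
  · rw [ha j hj, hb j hj]

theorem exists_subset_isColBasis {J : Finset ι}
    (h : Submodule.span ℝ (m '' (J : Set ι)) = ⊤) : ∃ B ⊆ J, IsColBasis m B := by
  obtain ⟨b, hbJ, -, hsp, hli⟩ := exists_linearIndepOn_extension (K := ℝ) (v := m) (s := ∅)
    (t := (J : Set ι)) (linearIndepOn_empty ℝ m) (Set.empty_subset _)
  lift b to Finset ι using J.finite_toSet.subset hbJ
  refine ⟨b, by exact_mod_cast hbJ, isColBasis_of_linearIndepOn hli ?_⟩
  rw [eq_top_iff, ← h, Submodule.span_le]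
  exact hsp

theorem IsColBasis.span_eq_top (hB : IsColBasis m B) :
    Submodule.span ℝ (m '' (B : Set ι)) = ⊤ :=
  eq_top_iff.2 fun x _ => mem_span_image_iff_exists_linearCombination.2 (hB x).exists

/-- The basis of `V` formed by the vectors with index in `B`. -/
theorem IsColBasis.linearEquiv (hB : IsColBasis m B) :
    Nonempty ((B → ℝ) ≃ₗ[ℝ] V) := by
  let f : (B → ℝ) →ₗ[ℝ] V := Fintype.linearCombination ℝ fun j : B => m j
  have hf : ∀ a : ι → ℝ, (∀ j ∉ B, a j = 0) →
      f (fun j => a j) = Fintype.linearCombination ℝ m a := by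
    intro a ha
    simp only [f, Fintype.linearCombination_apply]
    rw [Finset.sum_coe_sort B (fun j => a j • m j)]
    exact Finset.sum_subset (Finset.subset_univ _) fun j _ hj => by simp [ha j hj]
  refine ⟨LinearEquiv.ofBijective f ⟨?_, fun x => ?_⟩⟩
  · rw [← LinearMap.ker_eq_bot, LinearMap.ker_eq_bot']
    intro c hc
    let a : ι → ℝ := fun j => if h : j ∈ B then c ⟨j, h⟩ else 0
    have ha : ∀ j ∉ B, a j = 0 := fun j hj => dif_neg hj
    have hac : (fun j : B => a j) = c := by
      funext j
      simp [a]
    have h0 : a = 0 := (hB 0).unique ⟨ha, by rw [← hf a ha, hac, hc]⟩ ⟨by simp, by simp⟩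
    rw [← hac, h0]
    rfl
  · obtain ⟨a, ha, hax⟩ := (hB x).exists
    exact ⟨_, (hf a ha).trans hax⟩

end

variable {s n : ℕ} {M : Matrix (Fin s) (Fin n) ℤ} {B : Finset (Fin n)}

theorem linearCombination_col (a : Fin n → ℝ) :
    Fintype.linearCombination ℝ (col s n M) a = (M.map (Int.cast : ℤ → ℝ)) *ᵥ a := by
  funext i
  simp [Fintype.linearCombination_apply, _root_.col, Matrix.mulVec, dotProduct, mul_comm]

theorem linearCombination_col_intCast (β : Fin n → ℤ) :
    Fintype.linearCombination ℝ (col s n M) (fun j => (β j : ℝ)) =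
      fun i => ((M *ᵥ β) i : ℝ) := by
  rw [linearCombination_col]
  funext i
  simp [Matrix.mulVec, dotProduct]

theorem IsColBasis.card_eq (hB : IsColBasis (col s n M) B) : B.card = s := by
  obtain ⟨e⟩ := hB.linearEquiv
  simpa using e.finrank_eq

theorem mulVec_comp_equiv (e : Fin s ≃ B) (k : Fin s → ℤ) :
    M.submatrix id (fun i => (e i : Fin n)) *ᵥ k =
      M *ᵥ fun j => if h : j ∈ B then k (e.symm ⟨j, h⟩) else 0 := by
  funext i
  simp only [Matrix.mulVec, dotProduct, Matrix.submatrix_apply, id_eq]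
  rw [← Finset.sum_subset (Finset.subset_univ B) (fun j _ hj => by simp [hj]),
    ← Finset.sum_coe_sort B, ← e.sum_comp]
  simp

theorem IsColBasis.det_ne_zero (hB : IsColBasis (col s n M) B) (e : Fin s ≃ B) :
    (M.submatrix id (fun i => (e i : Fin n))).det ≠ 0 := by
  rw [Ne, ← Matrix.exists_mulVec_eq_zero_iff]
  rintro ⟨k, hk, h0⟩
  rw [mulVec_comp_equiv] at h0
  set β : Fin n → ℤ := fun j => if h : j ∈ B then k (e.symm ⟨j, h⟩) else 0 with hβ
  have h1 : (fun j => (β j : ℝ)) = 0 :=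
    (hB 0).unique ⟨fun j hj => by simp [β, hj], by
      rw [linearCombination_col_intCast, h0]
      funext i
      simp⟩ ⟨by simp, by simp⟩
  refine hk (funext fun i => ?_)
  have := congrFun h1 (e i)
  simpa [β] using this

/-- `T` is the group of characters trivial on the lattice spanned by the columns in `B`, and
`D` its order. -/
structure IsDual (M : Matrix (Fin s) (Fin n) ℤ) (B : Finset (Fin n)) (T : Finset (Fin s → ℂ))
    (D : ℝ) : Prop where
  mem_iff : ∀ θ, θ ∈ T ↔ (∀ i, θ i ≠ 0) ∧ ∀ j ∈ B, charP s θ (fun i => M i j) = 1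
  norm_eq : ∀ θ ∈ T, ∀ y, ‖charP s θ y‖ = 1
  pos : 0 < D
  sum_eq : ∀ y, ∑ θ ∈ T, charP s θ y =
    if ∃ k : Fin n → ℤ, (∀ j ∉ B, k j = 0) ∧ M *ᵥ k = y then (D : ℂ) else 0
  detAbs_eq : ∀ θ, idxSet s n M θ = B → detAbs s n M θ = D

theorem IsColBasis.exists_isDual (hB : IsColBasis (col s n M) B) : ∃ T D, IsDual M B T D := by
  have e : Fin s ≃ B := (Fintype.equivFinOfCardEq (by simpa using hB.card_eq)).symm
  set N := M.submatrix id (fun i => (e i : Fin n)) with hN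
  obtain ⟨T, h1, h2, h3⟩ := exists_dual_group N (hB.det_ne_zero e)
  refine ⟨T, N.det.natAbs, ⟨fun θ => ?_, h2, ?_, fun y => ?_, ?_⟩⟩
  · rw [h1]
    refine and_congr_right fun _ => ⟨fun h j hj => ?_, fun h j => h _ (e j).2⟩
    simpa [N] using h (e.symm ⟨j, hj⟩)
  · exact_mod_cast Int.natAbs_pos.2 (hB.det_ne_zero e)
  · rw [h3]
    congr 1
    · rw [eq_iff_iff]
      constructor
      · rintro ⟨k, hk⟩
        exact ⟨_, fun j hj => dif_neg hj, (mulVec_comp_equiv e k).symm.trans hk⟩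
      · rintro ⟨k, hk, hy⟩
        refine ⟨fun i => k (e i), ?_⟩
        rw [hN, mulVec_comp_equiv, ← hy]
        congr 1
        funext j
        by_cases hj : j ∈ B
        · simp [hj]
        · simp [hj, hk j hj]
  · rintro θ rfl
    rw [detAbs]
    set A : Matrix (Fin s) (idxSet s n M θ) ℝ := Matrix.of fun i j => (M i (j : Fin n) : ℝ)
    have hA : A * Aᵀ = N.map (Int.cast : ℤ → ℝ) * (N.map (Int.cast : ℤ → ℝ))ᵀ := by
      ext i k
      simp only [Matrix.mul_apply, Matrix.transpose_apply]
      rw [← e.sum_comp]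
      rfl
    have hdet : (N.map (Int.cast : ℤ → ℝ)).det = (N.det : ℝ) :=
      ((Int.castRingHom ℝ).map_det N).symm
    rw [hA, Matrix.det_mul, Matrix.det_transpose, Real.sqrt_mul_self_eq_abs, hdet]
    rw [Nat.cast_natAbs, Int.cast_abs]

end Bases

section OnePrime

variable {s n : ℕ} {M : Matrix (Fin s) (Fin n) ℤ} {B : Finset (Fin n)}

theorem mem_idxSet {θ : Fin s → ℂ} {j : Fin n} :
    j ∈ idxSet s n M θ ↔ charP s θ (fun i => M i j) = 1 := by
  simp [idxSet]

theorem charP_single (θ : Fin s → ℂ) (i : Fin s) (d : ℤ) :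
    charP s θ (Pi.single i d) = θ i ^ d := by
  rw [_root_.charP, Finset.prod_eq_single i]
  · simp
  · intro b _ hb
    simp [hb]
  · simp

theorem zpow_det_eq_one {θ : Fin s → ℂ} (h0 : ∀ i, θ i ≠ 0) (N : Matrix (Fin s) (Fin s) ℤ)
    (h : ∀ j, charP s θ (fun i => N i j) = 1) (i : Fin s) : θ i ^ N.det = 1 := by
  have h1 : N *ᵥ (N.adjugate *ᵥ Pi.single i 1) = Pi.single i N.det := by
    rw [Matrix.mulVec_mulVec, Matrix.mul_adjugate, Matrix.smul_mulVec, Matrix.one_mulVec]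
    funext k
    simp [Pi.single_apply]
  rw [← charP_single, ← h1, charP_mulVec h0]
  simp [h]

/-- For a 1-prime matrix, a character trivial on a basis and one further column is trivial. -/
theorem IsOnePrime.eq_one (hM : IsOnePrime s n M) (hB : IsColBasis (col s n M) B)
    {θ : Fin s → ℂ} (h0 : ∀ i, θ i ≠ 0) (hθ : ∀ j ∈ B, charP s θ (fun i => M i j) = 1)
    {w : Fin n} (hw : w ∉ B) (hθw : charP s θ (fun i => M i w) = 1) : θ = fun _ => 1 := by
  have hY := hM (insert w B) (by rw [Finset.card_insert_of_notMem hw, hB.card_eq]) (by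
    rw [eq_top_iff, ← hB.span_eq_top]
    exact Submodule.span_mono (Set.image_mono (by simp)))
  funext i
  rw [← orderOf_eq_one_iff, ← Nat.dvd_one, ← hY]
  refine Finset.dvd_gcd fun g hg => ?_
  have hgY := (Finset.mem_filter.1 hg).2.1
  rw [orderOf_dvd_iff_pow_eq_one]
  have h := zpow_det_eq_one h0 (M.submatrix id g) (fun j => by
    rcases Finset.mem_insert.1 (hgY j) with h | h
    · simpa [h] using hθw
    · simpa using hθ _ h) i
  rcases Int.natAbs_eq (M.submatrix id g).det with hd | hd
  · rw [hd] at h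
    exact_mod_cast h
  · rw [hd, _root_.zpow_neg, inv_eq_one] at h
    exact_mod_cast h

theorem IsOnePrime.idxSet_eq (hM : IsOnePrime s n M) (hB : IsColBasis (col s n M) B)
    {θ : Fin s → ℂ} (h0 : ∀ i, θ i ≠ 0) (hθ : ∀ j ∈ B, charP s θ (fun i => M i j) = 1)
    (hne : θ ≠ fun _ => 1) : idxSet s n M θ = B := by
  ext w
  rw [mem_idxSet]
  exact ⟨fun h => by_contra fun hw => hne (hM.eq_one hB h0 hθ hw h), hθ w⟩

theorem IsOnePrime.isColBasis_idxSet (hM : IsOnePrime s n M) {θ : Fin s → ℂ}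
    (hθ : θ ∈ Aset s n M) (hne : θ ≠ fun _ => 1) : IsColBasis (col s n M) (idxSet s n M θ) := by
  obtain ⟨h0, h1⟩ := hθ
  obtain ⟨B, hBJ, hB⟩ := exists_subset_isColBasis (m := col s n M) (J := idxSet s n M θ)
    (by simpa [idxSet] using h1)
  rw [hM.idxSet_eq hB h0 (fun j hj => mem_idxSet.1 (hBJ hj)) hne]
  exact hB

theorem IsColBasis.mem_Aset (hB : IsColBasis (col s n M) B)
    {θ : Fin s → ℂ} (h0 : ∀ i, θ i ≠ 0) (hθ : ∀ j ∈ B, charP s θ (fun i => M i j) = 1) :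
    θ ∈ Aset s n M := by
  refine ⟨h0, ?_⟩
  rw [eq_top_iff, ← hB.span_eq_top]
  exact Submodule.span_mono (Set.image_mono fun j hj => hθ j hj)

end OnePrime

section FundamentalCone

variable {s n : ℕ} {M : Matrix (Fin s) (Fin n) ℤ} {B : Finset (Fin n)} {Ω : Set (Fin s → ℝ)}

theorem mem_coneOf {J : Finset (Fin n)} {x : Fin s → ℝ} :
    x ∈ coneOf s n M J ↔ ∃ a : Fin n → ℝ, (∀ j, 0 ≤ a j) ∧ (∀ j ∉ J, a j = 0) ∧
      Fintype.linearCombination ℝ (col s n M) a = x := by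
  simp only [coneOf, Set.mem_ofPred_eq, Fintype.linearCombination_apply, eq_comm]

theorem isGeneric_of_notMem_badSet {x : Fin s → ℝ} (hx : x ∉ badSet s n M) :
    IsGeneric (col s n M) x := by
  intro a ha hax y
  let J : Finset (Fin n) := Finset.univ.filter fun j => a j ≠ 0
  have hspan : Submodule.span ℝ (col s n M '' (J : Set (Fin n))) = ⊤ := by
    by_contra h
    refine hx (Set.mem_biUnion (x := J) h (mem_coneOf.2 ⟨a, ha, fun j hj => ?_, hax⟩))
    simpa [J] using hj
  obtain ⟨b, hb, hby⟩ := mem_span_image_iff_exists_linearCombination.1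
    (hspan ▸ Submodule.mem_top : y ∈ Submodule.span ℝ (col s n M '' (J : Set (Fin n))))
  exact ⟨b, fun j hj => hb j (by simp [J, hj]), hby⟩

theorem IsColBasis.mem_coneOf_iff (hB : IsColBasis (col s n M) B) {x : Fin s → ℝ} :
    x ∈ coneOf s n M B ↔ ∀ j, 0 ≤ coef (col s n M) B x j := by
  rw [mem_coneOf]
  constructor
  · rintro ⟨a, ha, haB, hax⟩
    rw [← hB.eq_coef haB hax]
    exact ha
  · intro h
    exact ⟨_, h, fun j hj => hB.coef_of_notMem x hj, hB.linearCombination_coef x⟩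

theorem IsColBasis.continuous_coef (hB : IsColBasis (col s n M) B) (j : Fin n) :
    Continuous fun x => coef (col s n M) B x j :=
  (continuous_apply j).comp hB.coefₗ.continuous_of_finiteDimensional

theorem IsColBasis.isClosed_coneOf (hB : IsColBasis (col s n M) B) :
    IsClosed (coneOf s n M B) := by
  have : coneOf s n M B = ⋂ j, {x | 0 ≤ coef (col s n M) B x j} := by
    ext x
    simp [hB.mem_coneOf_iff]
  rw [this]
  exact isClosed_iInter fun j => isClosed_le continuous_const (hB.continuous_coef j)

theorem IsColBasis.feasible_of_mem_coneOf (hB : IsColBasis (col s n M) B) {x : Fin s → ℝ}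
    (hx : x ∉ badSet s n M) (hxB : x ∈ coneOf s n M B) : Feasible (col s n M) x B := by
  obtain ⟨a, ha, haB, hax⟩ := mem_coneOf.1 hxB
  exact (isGeneric_of_notMem_badSet hx).feasible hB ha haB hax

/-- A fundamental cone meeting the cone of a basis is contained in it. -/
theorem IsFundCone.subset_coneOf (hΩ : IsFundCone s n M Ω) (hB : IsColBasis (col s n M) B)
    (h : (Ω ∩ coneOf s n M B).Nonempty) : Ω ⊆ coneOf s n M B := by
  obtain ⟨x, hx, rfl⟩ := hΩ
  set X := interior (coneOf s n M Finset.univ) \ badSet s n M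
  set U : Set (Fin s → ℝ) := {y | ∀ j ∈ B, 0 < coef (col s n M) B y j} with hU
  have hUo : IsOpen U := by
    have : U = ⋂ j ∈ B, {y | 0 < coef (col s n M) B y j} := by
      ext y
      simp [U]
    rw [this]
    exact isOpen_biInter_finset fun j _ => isOpen_lt continuous_const (hB.continuous_coef j)
  have hUB : U ⊆ coneOf s n M B := fun y hy => hB.mem_coneOf_iff.2 (Feasible.coef_nonneg ⟨hB, hy⟩)
  have hsub : connectedComponentIn X x ⊆ X := connectedComponentIn_subset X x
  refine Set.Subset.trans ?_ hUB
  refine isPreconnected_connectedComponentIn.subset_left_of_subset_union hUo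
    hB.isClosed_coneOf.isOpen_compl (Set.disjoint_compl_right_iff_subset.2 hUB) ?_ ?_
  · intro y hy
    by_cases hyB : y ∈ coneOf s n M B
    · exact Or.inl (hB.feasible_of_mem_coneOf (hsub hy).2 hyB).2
    · exact Or.inr hyB
  · obtain ⟨y, hy, hyB⟩ := h
    exact ⟨y, hy, (hB.feasible_of_mem_coneOf (hsub hy).2 hyB).2⟩

/-- A point of a fundamental cone, with the properties needed for the counting formula. -/
theorem IsFundCone.exists_point (hΩ : IsFundCone s n M Ω) :
    ∃ γ, IsGeneric (col s n M) γ ∧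
      (∃ a : Fin n → ℝ, (∀ j, 0 ≤ a j) ∧ Fintype.linearCombination ℝ (col s n M) a = γ) ∧
      (∀ B, IsColBasis (col s n M) B →
        (Feasible (col s n M) γ B ↔ (Ω ∩ coneOf s n M B).Nonempty)) ∧
      ∀ B, Feasible (col s n M) γ B → ∀ x ∈ closure Ω, ∀ j, 0 ≤ coef (col s n M) B x j := by
  obtain ⟨γ, hγ, hΩγ⟩ := id hΩ
  have hγΩ : γ ∈ Ω := hΩγ ▸ mem_connectedComponentIn hγ
  have hiff : ∀ B, IsColBasis (col s n M) B →
      (Feasible (col s n M) γ B ↔ (Ω ∩ coneOf s n M B).Nonempty) := by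
    refine fun B hB => ⟨fun h => ⟨γ, hγΩ, hB.mem_coneOf_iff.2 h.coef_nonneg⟩, fun h => ?_⟩
    exact hB.feasible_of_mem_coneOf hγ.2 (hΩ.subset_coneOf hB h hγΩ)
  refine ⟨γ, isGeneric_of_notMem_badSet hγ.2, ?_, hiff, fun B hB x hx => ?_⟩
  · obtain ⟨a, ha, -, haγ⟩ := mem_coneOf.1 (interior_subset hγ.1)
    exact ⟨a, ha, haγ⟩
  · rw [← hB.1.mem_coneOf_iff]
    exact closure_minimal (hΩ.subset_coneOf hB.1 ((hiff B hB.1).1 hB)) hB.1.isClosed_coneOf hx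

theorem isPointed_of_zero_notMem_convexHull
    (h : (0 : Fin s → ℝ) ∉ convexHull ℝ (Set.range (col s n M))) : IsPointed (col s n M) := by
  have hcl : IsClosed (convexHull ℝ (Set.range (col s n M))) :=
    ((Set.finite_range (_root_.col s n M)).isCompact_convexHull ℝ).isClosed
  obtain ⟨f, u, h0, hf⟩ := geometric_hahn_banach_point_closed (convex_convexHull ℝ _) hcl h
  refine ⟨f.toLinearMap, fun j => ?_⟩
  rw [map_zero] at h0
  exact h0.trans (hf _ (subset_convexHull ℝ _ ⟨j, rfl⟩))

end FundamentalCone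

section VertexSum

variable {s n : ℕ} {M : Matrix (Fin s) (Fin n) ℤ} {B : Finset (Fin n)} {T : Finset (Fin s → ℂ)}
  {D : ℝ}

/-- The generating function of the lattice points in the flipped cone at the vertex given by a
basis `B`. -/
noncomputable def vertexTerm (M : Matrix (Fin s) (Fin n) ℤ) (u : Fin n → ℝ) (B : Finset (Fin n))
    (T : Finset (Fin s → ℂ)) (D : ℝ) (α : Fin s → ℤ) : ℂ :=
  Complex.exp ((u ⬝ᵥ coef (col s n M) B (fun i => (α i : ℝ)) : ℝ) : ℂ) / (D : ℂ) *
    ∑ θ ∈ T, charP s θ α *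
      ∏ w ∈ Bᶜ, (1 - Complex.exp ((redCost (col s n M) u B w : ℝ) : ℂ) *
        charP s θ (fun i => -(M i w)))⁻¹

/-- Extension by zero of a vector indexed by the complement of `B`. -/
def extendCompl (B : Finset (Fin n)) (k : ↥(Bᶜ) → ℤ) : Fin n → ℤ :=
  fun j => if h : j ∈ Bᶜ then k ⟨j, h⟩ else 0

theorem extendCompl_of_mem (k : ↥(Bᶜ) → ℤ) {j : Fin n} (hj : j ∈ B) : extendCompl B k j = 0 :=
  dif_neg (by simpa using hj)

theorem extendCompl_coe (k : ↥(Bᶜ) → ℤ) (w : ↥(Bᶜ)) : extendCompl B k w = k w :=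
  dif_pos w.2

theorem charP_mulVec_extendCompl {θ : Fin s → ℂ} (h0 : ∀ i, θ i ≠ 0) (k : ↥(Bᶜ) → ℤ) :
    charP s θ (-(M *ᵥ extendCompl B k)) = ∏ w : ↥(Bᶜ), charP s θ (fun i => -(M i w)) ^ k w := by
  rw [charP_neg h0, charP_mulVec h0, ← Finset.prod_inv_distrib,
    ← Finset.prod_subset (Finset.subset_univ Bᶜ), ← Finset.prod_coe_sort Bᶜ]
  · refine Finset.prod_congr rfl fun w _ => ?_
    rw [extendCompl_coe, ← _root_.inv_zpow, ← charP_neg h0]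
    rfl
  · intro j _ hj
    rw [extendCompl_of_mem k (by simpa using hj)]
    simp

/-- The summand of the lattice cone at the vertex `B`, in terms of the nonbasic coordinates. -/
noncomputable def nonbasicTerm (M : Matrix (Fin s) (Fin n) ℤ) (u : Fin n → ℝ)
    (B : Finset (Fin n)) (α : Fin s → ℤ) (k : ↥(Bᶜ) → ℤ) : ℂ :=
  if ∃ c : Fin n → ℤ, (∀ j ∉ B, c j = 0) ∧ M *ᵥ c = α - M *ᵥ extendCompl B k then
    Complex.exp ((u ⬝ᵥ coef (col s n M) B (fun i => (α i : ℝ)) : ℝ) : ℂ) *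
      ∏ w : ↥(Bᶜ), (((flipInd (redCost (col s n M) u B w) (k w) : ℝ) : ℂ) *
        Complex.exp ((redCost (col s n M) u B w : ℝ) : ℂ) ^ k w) else 0

theorem hasSum_const_mul {κ : Type*} {f : κ → ℂ} {a : ℂ} (c : ℂ) (h : HasSum f a) :
    HasSum (fun k => c * f k) (c * a) :=
  h.mul_left c

theorem hasSum_finset_sum {κ ι : Type*} {f : ι → κ → ℂ} {a : ι → ℂ} {t : Finset ι}
    (h : ∀ i ∈ t, HasSum (f i) (a i)) : HasSum (fun k => ∑ i ∈ t, f i k) (∑ i ∈ t, a i) :=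
  hasSum_sum h

theorem IsDual.hasSum_nonbasicTerm (hT : IsDual M B T D) {u : Fin n → ℝ}
    (hu : ∀ w ∉ B, redCost (col s n M) u B w ≠ 0) (α : Fin s → ℤ) :
    HasSum (nonbasicTerm M u B α) (vertexTerm M u B T D α) := by
  have h1 : ∀ θ ∈ T, HasSum (fun k : ↥(Bᶜ) → ℤ => charP s θ α *
      ∏ w : ↥(Bᶜ), (((flipInd (redCost (col s n M) u B w) (k w) : ℝ) : ℂ) *
        (Complex.exp ((redCost (col s n M) u B w : ℝ) : ℂ) *
          charP s θ (fun i => -(M i w))) ^ k w))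
      (charP s θ α * ∏ w ∈ Bᶜ, (1 - Complex.exp ((redCost (col s n M) u B w : ℝ) : ℂ) *
        charP s θ (fun i => -(M i w)))⁻¹) := by
    intro θ hθ
    rw [← Finset.prod_coe_sort Bᶜ]
    refine hasSum_const_mul _ (hasSum_prod_pi (fun (w : ↥(Bᶜ)) (k : ℤ) =>
      ((flipInd (redCost (col s n M) u B w) (k : ℝ) : ℝ) : ℂ) *
        (Complex.exp ((redCost (col s n M) u B w : ℝ) : ℂ) *
          charP s θ (fun i => -(M i w))) ^ k) _ fun w => ?_)
    refine hasSum_flipInd_mul_zpow (hu w (Finset.mem_compl.1 w.2)) ?_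
    rw [norm_mul, hT.norm_eq θ hθ, mul_one, Complex.norm_exp, Complex.ofReal_re]
  have h2 := hasSum_const_mul
    (Complex.exp ((u ⬝ᵥ coef (col s n M) B (fun i => (α i : ℝ)) : ℝ) : ℂ) / (D : ℂ))
    (hasSum_finset_sum h1)
  refine (congrArg (fun g => HasSum g (vertexTerm M u B T D α)) (funext fun k => ?_)).mpr h2
  have h3 : ∀ θ ∈ T, charP s θ α *
      ∏ w : ↥(Bᶜ), (((flipInd (redCost (col s n M) u B w) (k w) : ℝ) : ℂ) *
        (Complex.exp ((redCost (col s n M) u B w : ℝ) : ℂ) *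
          charP s θ (fun i => -(M i w))) ^ k w) =
      (∏ w : ↥(Bᶜ), (((flipInd (redCost (col s n M) u B w) (k w) : ℝ) : ℂ) *
        Complex.exp ((redCost (col s n M) u B w : ℝ) : ℂ) ^ k w)) *
        charP s θ (α - M *ᵥ extendCompl B k) := by
    intro θ hθ
    have h0 := ((hT.mem_iff θ).1 hθ).1
    rw [sub_eq_add_neg, charP_add h0, charP_mulVec_extendCompl h0, mul_left_comm,
      ← Finset.prod_mul_distrib]
    simp only [mul_zpow, mul_assoc]
  rw [Finset.sum_congr rfl h3, ← Finset.mul_sum, hT.sum_eq, nonbasicTerm]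
  have hD : (D : ℂ) ≠ 0 := by exact_mod_cast hT.pos.ne'
  split_ifs
  · field_simp
  · simp

theorem IsColBasis.eq_of_mulVec_eq (hB : IsColBasis (col s n M) B) {β β' : Fin n → ℤ}
    (h : M *ᵥ β = M *ᵥ β') (hc : ∀ j ∉ B, β j = β' j) : β = β' := by
  have h1 : (fun j => ((β - β') j : ℝ)) = 0 :=
    (hB 0).unique ⟨fun j hj => by simp [hc j hj], by
      rw [linearCombination_col_intCast, Matrix.mulVec_sub, h, sub_self]
      funext i
      simp⟩ ⟨by simp, by simp⟩
  funext j
  have := congrFun h1 j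
  simpa [sub_eq_zero] using this

theorem IsColBasis.hasSum_flip (hB : IsColBasis (col s n M) B) (hT : IsDual M B T D)
    {u : Fin n → ℝ} (hu : ∀ w ∉ B, redCost (col s n M) u B w ≠ 0) (α : Fin s → ℤ) :
    HasSum (fun β : Fin n → ℤ => if M *ᵥ β = α then
      Complex.exp ((u ⬝ᵥ (fun j => (β j : ℝ)) : ℝ) : ℂ) *
        ∏ w ∈ Bᶜ, ((flipInd (redCost (col s n M) u B w) (β w) : ℝ) : ℂ) else 0)
      (vertexTerm M u B T D α) := by
  set f : (Fin n → ℤ) → ℂ := fun β => if M *ᵥ β = α then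
      Complex.exp ((u ⬝ᵥ (fun j => (β j : ℝ)) : ℝ) : ℂ) *
        ∏ w ∈ Bᶜ, ((flipInd (redCost (col s n M) u B w) (β w) : ℝ) : ℂ) else 0 with hf
  have hsplit : ∀ β c : Fin n → ℤ, (∀ j ∉ B, c j = 0) →
      β = c + extendCompl B (fun w => β w) → ∀ y, M *ᵥ β = y →
      M *ᵥ c = y - M *ᵥ extendCompl B (fun w => β w) := by
    intro β c _ hβ y hy
    rw [eq_sub_iff_add_eq, ← Matrix.mulVec_add, ← hβ, hy]
  have hdec : ∀ β : Fin n → ℤ, β = (fun j => if j ∈ B then β j else 0) +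
      extendCompl B (fun w => β w) := by
    intro β
    funext j
    by_cases hj : j ∈ B <;> simp [extendCompl, hj]
  have hgf : ∀ β : Fin n → ℤ, M *ᵥ β = α →
      nonbasicTerm M u B α (fun w : ↥(Bᶜ) => β w) = f β := by
    intro β hβ
    rw [nonbasicTerm, if_pos ⟨_, fun j hj => if_neg hj,
      hsplit β _ (fun j hj => if_neg hj) (hdec β) α hβ⟩, hf]
    simp only [hβ, if_true]
    rw [dotProduct_eq_add_sum_redCost hB u (fun j => (β j : ℝ)), linearCombination_col_intCast, hβ,
      Finset.prod_mul_distrib, Finset.prod_coe_sort Bᶜ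
        (fun w => ((flipInd (redCost (col s n M) u B w) (β w) : ℝ) : ℂ)),
      Finset.prod_coe_sort Bᶜ
        (fun w => Complex.exp ((redCost (col s n M) u B w : ℝ) : ℂ) ^ β w)]
    push_cast
    rw [Complex.exp_add, Complex.exp_sum]
    simp only [Complex.exp_int_mul]
    ring
  refine (hasSum_iff_hasSum_of_ne_zero_bij (f := nonbasicTerm M u B α) (g := f)
    (fun β w => (β : Fin n → ℤ) w) ?_ ?_ ?_).1 (hT.hasSum_nonbasicTerm hu α)
  · have hsupp : ∀ β : Function.support f, M *ᵥ (β : Fin n → ℤ) = α := fun β => by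
      by_contra h
      exact β.2 (if_neg h)
    intro β β' h
    refine Subtype.ext (hB.eq_of_mulVec_eq ((hsupp β).trans (hsupp β').symm) fun j hj => ?_)
    exact congrFun h ⟨j, by simpa using hj⟩
  · intro k hk
    have hk' := hk
    rw [Function.mem_support, nonbasicTerm] at hk'
    obtain ⟨c, hc, hcM⟩ := (ite_ne_right_iff.1 hk').1
    have hβ : M *ᵥ (c + extendCompl B k) = α := by
      rw [Matrix.mulVec_add, hcM, sub_add_cancel]
    have hr : (fun w : ↥(Bᶜ) => (c + extendCompl B k) w) = k := by
      funext w
      rw [Pi.add_apply, extendCompl_coe, hc _ (Finset.mem_compl.1 w.2), zero_add]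
    refine ⟨⟨c + extendCompl B k, ?_⟩, hr⟩
    rw [Function.mem_support, ← hgf _ hβ, hr]
    exact hk
  · intro β
    refine hgf _ ?_
    by_contra h
    exact β.2 (if_neg h)

variable {γ : Fin s → ℝ}

theorem flipSum_eq_ite (hm : IsPointed (col s n M)) (hγ : IsGeneric (col s n M) γ)
    (hne : ∃ B, Feasible (col s n M) γ B) {u : Fin n → ℝ}
    (hu : ∀ j, IsGenericLine (col s n M) u (-Pi.single j 1)) {β : Fin n → ℤ}
    (hβ : ∀ B, Feasible (col s n M) γ B →
      ∀ j, 0 ≤ coef (col s n M) B (fun i => ((M *ᵥ β) i : ℝ)) j) :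
    flipSum (col s n M) γ u (fun j => (β j : ℝ)) = if ∀ j, 0 ≤ β j then 1 else 0 := by
  split_ifs with h
  · by_cases hn : Nonempty (Fin n)
    · exact flipSum_eq_one hm hγ (hu hn.some).ne_zero (fun j => by exact_mod_cast h j) hne
    · exact flipSum_eq_one hm hγ (fun B w => (hn ⟨w⟩).elim) (fun j => by exact_mod_cast h j) hne
  · push Not at h
    obtain ⟨j, hj⟩ := h
    refine flipSum_eq_zero hm hγ (hu j) (by exact_mod_cast hj) fun B hB => ?_
    rw [linearCombination_col_intCast]
    exact hβ B hB j

theorem IsPointed.finite_solutions (hm : IsPointed (col s n M)) (α : Fin s → ℤ) :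
    {β : Fin n → ℕ | ∀ i, ∑ j, M i j * (β j : ℤ) = α i}.Finite := by
  obtain ⟨ξ, hξ⟩ := hm
  have hbound : ∀ β ∈ {β : Fin n → ℕ | ∀ i, ∑ j, M i j * (β j : ℤ) = α i}, ∀ j,
      β j ≤ ⌊ξ (fun i => (α i : ℝ)) / ξ (col s n M j)⌋₊ := by
    intro β hβ j
    refine Nat.le_floor ?_
    rw [le_div_iff₀ (hξ j)]
    have h1 : Fintype.linearCombination ℝ (col s n M) (fun j => ((β j : ℤ) : ℝ)) =
        fun i => (α i : ℝ) := by
      rw [linearCombination_col_intCast (fun j => (β j : ℤ))]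
      funext i
      exact_mod_cast hβ i
    rw [← h1, Fintype.linearCombination_apply, map_sum]
    simp only [map_smul, smul_eq_mul, Int.cast_natCast]
    exact Finset.single_le_sum (f := fun j => (β j : ℝ) * ξ (col s n M j))
      (fun j _ => mul_nonneg (Nat.cast_nonneg _) (hξ j).le) (Finset.mem_univ j)
  exact (Set.Finite.pi' fun j => Set.finite_Iic _).subset fun β hβ j => hbound β hβ j

/-- The weighted number of solutions as a sum over the feasible bases. -/
theorem sum_exp_eq_sum_vertexTerm (hm : IsPointed (col s n M)) (hγ : IsGeneric (col s n M) γ)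
    (hne : ∃ B, Feasible (col s n M) γ B) {u : Fin n → ℝ}
    (hu : ∀ j, IsGenericLine (col s n M) u (-Pi.single j 1))
    {T : Finset (Fin n) → Finset (Fin s → ℂ)} {D : Finset (Fin n) → ℝ}
    (hT : ∀ B, IsColBasis (col s n M) B → IsDual M B (T B) (D B)) {α : Fin s → ℤ}
    (hα : ∀ B, Feasible (col s n M) γ B → ∀ j, 0 ≤ coef (col s n M) B (fun i => (α i : ℝ)) j) :
    ∑ β ∈ (hm.finite_solutions α).toFinset,
        Complex.exp ((u ⬝ᵥ (fun j => (β j : ℝ)) : ℝ) : ℂ) =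
      ∑ B with Feasible (col s n M) γ B, vertexTerm M u B (T B) (D B) α := by
  set f : (Fin n → ℤ) → ℂ := fun β => if M *ᵥ β = α ∧ ∀ j, 0 ≤ β j then
    Complex.exp ((u ⬝ᵥ (fun j => (β j : ℝ)) : ℝ) : ℂ) else 0 with hf
  have h1 : HasSum f (∑ B with Feasible (col s n M) γ B, vertexTerm M u B (T B) (D B) α) := by
    have h := hasSum_finset_sum (t := Finset.univ.filter fun B => Feasible (_root_.col s n M) γ B)
      fun B hB => have hB' := (Finset.mem_filter.1 hB).2.1
        hB'.hasSum_flip (hT B hB') (fun w hw => (hu w).ne_zero B w hB' hw) α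
    refine (congrArg (fun g : (Fin n → ℤ) → ℂ => HasSum g _) (funext fun β => ?_)).mpr h
    by_cases hβ : M *ᵥ β = α
    · simp only [hf, hβ, true_and, if_true]
      rw [← Finset.mul_sum]
      have h2 := flipSum_eq_ite hm hγ hne hu (β := β) (by rw [hβ]; exact hα)
      rw [flipSum] at h2
      have h3 := congrArg (fun x : ℝ => (x : ℂ)) h2
      push_cast at h3
      rw [h3]
      by_cases hpos : ∀ j, 0 ≤ β j
      · simp only [hpos, implies_true, if_true, Complex.ofReal_one, mul_one]
      · simp only [hpos, if_false, Complex.ofReal_zero, mul_zero]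
    · simp [hf, hβ]
  have hinj : Function.Injective fun (β : Fin n → ℕ) (j : Fin n) => (β j : ℤ) := by
    intro β β' h
    funext j
    exact Int.natCast_inj.1 (congrFun h j)
  have h2 : HasSum (f ∘ fun (β : Fin n → ℕ) (j : Fin n) => (β j : ℤ))
      (∑ B with Feasible (col s n M) γ B, vertexTerm M u B (T B) (D B) α) := by
    rw [hinj.hasSum_iff]
    · exact h1
    · intro β hβ
      refine if_neg fun h => hβ ⟨fun j => (β j).toNat, ?_⟩
      funext j
      exact Int.toNat_of_nonneg (h.2 j)
  have hiff : ∀ β : Fin n → ℕ, β ∈ (hm.finite_solutions α).toFinset ↔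
      M *ᵥ (fun j => (β j : ℤ)) = α := by
    intro β
    rw [Set.Finite.mem_toFinset, funext_iff]
    rfl
  have h0 : ∀ β ∉ (hm.finite_solutions α).toFinset,
      (f ∘ fun (β : Fin n → ℕ) (j : Fin n) => (β j : ℤ)) β = 0 := by
    intro β hβ
    rw [hiff] at hβ
    exact if_neg fun h => hβ h.1
  have h3 : HasSum (f ∘ fun (β : Fin n → ℕ) (j : Fin n) => (β j : ℤ))
      (∑ β ∈ (hm.finite_solutions α).toFinset, f fun j => (β j : ℤ)) :=
    hasSum_sum_of_ne_finset_zero h0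
  rw [← h3.unique h2]
  refine Finset.sum_congr rfl fun β hβ => ?_
  rw [hiff] at hβ
  simp [hf, hβ]

end VertexSum

section TaylorLimit

open Filter Topology Asymptotics

/-- `q` approximates `f` at the origin up to terms of order larger than `N`. -/
def IsTaylorApprox (N : ℕ) (f : ℂ → ℂ) (q : Polynomial ℂ) : Prop :=
  (fun z => f z - q.eval z) =O[𝓝 0] fun z => z ^ (N + 1)

theorem eq_coeff_of_tendsto_eval_div_pow {N : ℕ} : ∀ {p : Polynomial ℂ} {L : ℂ},
    Tendsto (fun ε : ℝ => p.eval (ε : ℂ) / (ε : ℂ) ^ N) (𝓝[>] 0) (𝓝 L) → L = p.coeff N := by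
  have hid : Tendsto (fun ε : ℝ => (ε : ℂ)) (𝓝[>] 0) (𝓝 0) :=
    (by simpa using Complex.continuous_ofReal.tendsto 0 :
      Tendsto (fun ε : ℝ => (ε : ℂ)) (𝓝 0) (𝓝 0)).mono_left nhdsWithin_le_nhds
  have hev : ∀ p : Polynomial ℂ,
      Tendsto (fun ε : ℝ => p.eval (ε : ℂ)) (𝓝[>] 0) (𝓝 (p.coeff 0)) := fun p => by
    rw [p.coeff_zero_eq_eval_zero]
    exact (p.continuous.tendsto 0).comp hid
  induction N with
  | zero =>
    intro p L h
    simp only [pow_zero, div_one] at h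
    exact tendsto_nhds_unique h (hev p)
  | succ N ih =>
    intro p L h
    have h0 : p.coeff 0 = 0 := by
      refine tendsto_nhds_unique (hev p) ?_
      have h1 : Tendsto (fun ε : ℝ => p.eval (ε : ℂ) / (ε : ℂ) ^ (N + 1) * (ε : ℂ) ^ (N + 1))
          (𝓝[>] 0) (𝓝 (L * 0 ^ (N + 1))) := h.mul (hid.pow (N + 1))
      rw [zero_pow (Nat.succ_ne_zero N), mul_zero] at h1
      refine h1.congr' ?_
      filter_upwards [self_mem_nhdsWithin] with ε hε
      have hε' : (ε : ℂ) ≠ 0 := Complex.ofReal_ne_zero.2 (ne_of_gt hε)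
      exact div_mul_cancel₀ _ (pow_ne_zero _ hε')
    have hp : p = Polynomial.X * p.divX := by
      conv_lhs => rw [← p.X_mul_divX_add, h0]
      simp
    have hc : p.coeff (N + 1) = p.divX.coeff N := by rw [Polynomial.coeff_divX]
    rw [hc]
    refine ih (h.congr' ?_)
    filter_upwards [self_mem_nhdsWithin] with ε hε
    have hε' : (ε : ℂ) ≠ 0 := Complex.ofReal_ne_zero.2 (ne_of_gt hε)
    conv_lhs => rw [hp]
    rw [Polynomial.eval_mul, Polynomial.eval_X, pow_succ', mul_div_mul_left _ _ hε']

namespace IsTaylorApprox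

variable {N : ℕ} {f g : ℂ → ℂ} {p q : Polynomial ℂ}

theorem eq_coeff (h : IsTaylorApprox N f q) {L : ℂ}
    (hL : Tendsto (fun ε : ℝ => f ε / (ε : ℂ) ^ N) (𝓝[>] 0) (𝓝 L)) : L = q.coeff N := by
  have hid : Tendsto (fun ε : ℝ => (ε : ℂ)) (𝓝[>] 0) (𝓝 0) :=
    (by simpa using Complex.continuous_ofReal.tendsto 0 :
      Tendsto (fun ε : ℝ => (ε : ℂ)) (𝓝 0) (𝓝 0)).mono_left nhdsWithin_le_nhds
  have h1 : (fun ε : ℝ => (f ε - q.eval (ε : ℂ)) / (ε : ℂ) ^ N) =O[𝓝[>] 0]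
      fun ε : ℝ => (ε : ℂ) := by
    have h2 := (h.comp_tendsto hid).mul (isBigO_refl (fun ε : ℝ => ((ε : ℂ) ^ N)⁻¹) (𝓝[>] 0))
    refine (h2.congr' (Eventually.of_forall fun ε => ?_) ?_)
    · simp [div_eq_mul_inv]
    · filter_upwards [self_mem_nhdsWithin] with ε hε
      have hε' : (ε : ℂ) ≠ 0 := Complex.ofReal_ne_zero.2 (ne_of_gt hε)
      simp only [Function.comp_apply]
      rw [pow_succ', mul_assoc, mul_inv_cancel₀ (pow_ne_zero _ hε'), mul_one]
  have h3 := hL.sub (h1.trans_tendsto hid)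
  rw [sub_zero] at h3
  refine eq_coeff_of_tendsto_eval_div_pow (h3.congr fun ε => ?_)
  rw [← sub_div, sub_sub_cancel]

theorem mul (hf : IsTaylorApprox N f p) (hg : IsTaylorApprox N g q) (hc : ContinuousAt g 0) :
    IsTaylorApprox N (fun z => f z * g z) (p * q) := by
  have h1 : (fun z => (f z - p.eval z) * g z) =O[𝓝 0] fun z : ℂ => z ^ (N + 1) * 1 :=
    IsBigO.mul hf (hc.isBigO_one ℂ)
  have h2 : (fun z => p.eval z * (g z - q.eval z)) =O[𝓝 0] fun z : ℂ => 1 * z ^ (N + 1) :=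
    IsBigO.mul (p.continuous.continuousAt.isBigO_one ℂ) hg
  simp only [mul_one, one_mul] at h1 h2
  refine (h1.add h2).congr_left fun z => ?_
  rw [Polynomial.eval_mul]
  ring

theorem const_mul (hf : IsTaylorApprox N f p) (c : ℂ) :
    IsTaylorApprox N (fun z => c * f z) (Polynomial.C c * p) := by
  refine (IsBigO.const_mul_left hf c).congr_left fun z => ?_
  rw [Polynomial.eval_mul, Polynomial.eval_C, mul_sub]

theorem sum {ι : Type*} {t : Finset ι} {f : ι → ℂ → ℂ} {p : ι → Polynomial ℂ}
    (h : ∀ i ∈ t, IsTaylorApprox N (f i) (p i)) :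
    IsTaylorApprox N (fun z => ∑ i ∈ t, f i z) (∑ i ∈ t, p i) := by
  refine (IsBigO.sum (A := fun i z => f i z - (p i).eval z) h).congr_left fun z => ?_
  rw [Polynomial.eval_finsetSum, Finset.sum_apply, Finset.sum_sub_distrib]

end IsTaylorApprox

theorem isTaylorApprox_exp (N : ℕ) (c : ℂ) : IsTaylorApprox N (fun z => Complex.exp (z * c))
    (∑ k ∈ Finset.range (N + 1), Polynomial.C (c ^ k / (k.factorial : ℂ)) * Polynomial.X ^ k) := by
  have ht : Tendsto (fun z : ℂ => z * c) (𝓝 0) (𝓝 0) := by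
    simpa using (continuous_mul_const c).tendsto (0 : ℂ)
  have h1 := (Complex.exp_sub_sum_range_isBigO_pow (N + 1)).comp_tendsto ht
  have h2 : ((fun x : ℂ => x ^ (N + 1)) ∘ fun z : ℂ => z * c) =O[𝓝 0] fun z => z ^ (N + 1) := by
    refine ((isBigO_refl (fun z : ℂ => z ^ (N + 1)) (𝓝 0)).const_mul_left (c ^ (N + 1))).congr_left
      fun z => ?_
    simp only [Function.comp_apply, mul_pow]
    ring
  refine (h1.trans h2).congr_left fun z => ?_
  simp only [Function.comp_apply, Polynomial.eval_finsetSum, Polynomial.eval_mul,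
    Polynomial.eval_C, Polynomial.eval_pow, Polynomial.eval_X]
  refine congrArg _ (Finset.sum_congr rfl fun k _ => ?_)
  rw [mul_pow]
  ring

theorem AnalyticAt.exists_isTaylorApprox {f : ℂ → ℂ} (hf : AnalyticAt ℂ f 0) (N : ℕ) :
    ∃ q, IsTaylorApprox N f q := by
  obtain ⟨p, hp⟩ := hf
  refine ⟨∑ k ∈ Finset.range (N + 1), Polynomial.C (p.coeff k) * Polynomial.X ^ k, ?_⟩
  have h1 := hp.isBigO_sub_partialSum_pow (N + 1)
  have h2 : (fun z : ℂ => ‖z‖ ^ (N + 1)) =O[𝓝 0] fun z : ℂ => z ^ (N + 1) := by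
    simp only [← norm_pow]
    exact (isBigO_refl (fun z : ℂ => z ^ (N + 1)) (𝓝 0)).norm_left
  refine IsBigO.congr_left (h1.trans h2) fun z => ?_
  simp only [zero_add, FormalMultilinearSeries.partialSum, Polynomial.eval_finsetSum,
    Polynomial.eval_mul, Polynomial.eval_C, Polynomial.eval_pow, Polynomial.eval_X]
  refine congrArg _ (Finset.sum_congr rfl fun k _ => ?_)
  rw [p.apply_eq_pow_smul_coeff, smul_eq_mul, mul_comm]

/-- The leading behaviour at the origin of a combination of exponentials with poles of order `N`
is polynomial in the exponents. -/
theorem exists_mvPolynomial_eq_limit {ι : Type*} {s : ℕ} (t : Finset ι) (N : ℕ) (c : ι → ℂ)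
    (l : ι → Fin s → ℂ) (K : ι → ℂ → ℂ) (hK : ∀ i ∈ t, AnalyticAt ℂ (K i) 0) :
    ∃ P : MvPolynomial (Fin s) ℂ, P.totalDegree ≤ N ∧ ∀ (x : Fin s → ℂ) (L : ℂ),
      Tendsto (fun ε : ℝ => (∑ i ∈ t, c i * (Complex.exp (ε * (l i ⬝ᵥ x)) * K i ε)) /
        (ε : ℂ) ^ N) (𝓝[>] 0) (𝓝 L) → L = MvPolynomial.eval x P := by
  choose! q hq using fun i (hi : i ∈ t) => (hK i hi).exists_isTaylorApprox N
  refine ⟨∑ i ∈ t, ∑ k ∈ Finset.range (N + 1),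
    MvPolynomial.C (c i * ((q i).coeff (N - k) / (k.factorial : ℂ))) *
      (∑ a, MvPolynomial.C (l i a) * MvPolynomial.X a) ^ k, ?_, fun x L hL => ?_⟩
  · refine MvPolynomial.totalDegree_finsetSum_le fun i _ =>
      MvPolynomial.totalDegree_finsetSum_le fun k hk => ?_
    refine (MvPolynomial.totalDegree_mul _ _).trans ?_
    rw [MvPolynomial.totalDegree_C, zero_add]
    refine (MvPolynomial.totalDegree_pow _ _).trans ?_
    have h1 : (∑ a, MvPolynomial.C (l i a) * MvPolynomial.X a :
        MvPolynomial (Fin s) ℂ).totalDegree ≤ 1 := by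
      refine MvPolynomial.totalDegree_finsetSum_le fun a _ => ?_
      refine (MvPolynomial.totalDegree_mul _ _).trans ?_
      rw [MvPolynomial.totalDegree_C, MvPolynomial.totalDegree_X]
    calc _ ≤ k * 1 := Nat.mul_le_mul_left k h1
      _ ≤ N := by have := Finset.mem_range.1 hk; omega
  · have h1 := IsTaylorApprox.sum (t := t) (N := N)
      (f := fun i z => c i * (Complex.exp (z * (l i ⬝ᵥ x)) * K i z))
      fun i hi => ((isTaylorApprox_exp N (l i ⬝ᵥ x)).mul (hq i hi)
        (hK i hi).continuousAt).const_mul (c i)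
    rw [h1.eq_coeff hL, Polynomial.finsetSum_coeff, map_sum]
    refine Finset.sum_congr rfl fun i _ => ?_
    rw [Polynomial.coeff_C_mul, Finset.sum_mul, Polynomial.finsetSum_coeff, map_sum,
      Finset.mul_sum]
    refine Finset.sum_congr rfl fun k hk => ?_
    have hkN : k ≤ N := by have := Finset.mem_range.1 hk; omega
    rw [mul_assoc, Polynomial.coeff_C_mul, Polynomial.coeff_X_pow_mul', if_pos hkN]
    simp only [map_mul, map_pow, map_sum, MvPolynomial.eval_C, MvPolynomial.eval_X]
    simp only [dotProduct]
    ring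

/-- A product of simple poles at the origin is an analytic function divided by a power. -/
theorem exists_analyticAt_prod_one_sub_exp_inv {ι : Type*} (W : Finset ι) (r : ι → ℝ)
    (hr : ∀ w ∈ W, r w ≠ 0) : ∃ K : ℂ → ℂ, AnalyticAt ℂ K 0 ∧ ∀ ε : ℝ, 0 < ε →
      ∏ w ∈ W, (1 - Complex.exp ((ε * r w : ℝ) : ℂ))⁻¹ = K ε / (ε : ℂ) ^ W.card := by
  refine ⟨fun z => ∏ w ∈ W, -(dslope (fun z => Complex.exp (r w * z)) 0 z)⁻¹, ?_, ?_⟩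
  · refine Finset.analyticAt_fun_prod _ fun w hw => ?_
    have h1 : AnalyticAt ℂ (fun z : ℂ => Complex.exp (r w * z)) 0 := by fun_prop
    obtain ⟨p, hp⟩ := h1
    refine AnalyticAt.neg (AnalyticAt.inv hp.has_fpower_series_dslope_fslope.analyticAt ?_)
    rw [dslope_same]
    have h2 : HasDerivAt (fun z : ℂ => Complex.exp (r w * z)) (r w : ℂ) 0 := by
      have := ((hasDerivAt_id (0 : ℂ)).const_mul (r w : ℂ)).cexp
      simpa using this
    rw [h2.deriv]
    exact Complex.ofReal_ne_zero.2 (hr w hw)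
  · intro ε hε
    have hε' : (ε : ℂ) ≠ 0 := Complex.ofReal_ne_zero.2 (ne_of_gt hε)
    rw [Finset.card_eq_sum_ones, ← Finset.prod_pow_eq_pow_sum, ← Finset.prod_div_distrib]
    refine Finset.prod_congr rfl fun w _ => ?_
    rw [dslope_of_ne _ hε', slope_def_field, mul_zero, Complex.exp_zero, sub_zero, inv_div,
      pow_one, neg_div, div_right_comm, div_self hε', one_div,
      ← inv_neg, neg_sub, mul_comm (r w : ℂ), Complex.ofReal_mul]

end TaylorLimit

section Assembly

open Filter Topology

theorem redCost_smul {ι V : Type*} [Fintype ι] [DecidableEq ι] [AddCommGroup V] [Module ℝ V]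
    (m : ι → V) (ε : ℝ) (u : ι → ℝ) (B : Finset ι) (w : ι) :
    redCost m (ε • u) B w = ε * redCost m u B w := by
  rw [redCost, redCost, smul_dotProduct, smul_eq_mul]

theorem IsGenericLine.smul {ι V : Type*} [Fintype ι] [DecidableEq ι] [AddCommGroup V] [Module ℝ V]
    {m : ι → V} {u v : ι → ℝ} (h : IsGenericLine m u v) {ε : ℝ} (hε : ε ≠ 0) :
    IsGenericLine m (ε • u) v where
  ne_zero B w hB hw := by
    rw [redCost_smul]
    exact mul_ne_zero hε (h.ne_zero B w hB hw)
  ne_ratio B w w' hB hw hw' hne h1 h2 := by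
    rw [redCost_smul, redCost_smul, mul_assoc, mul_assoc]
    exact fun h3 => h.ne_ratio B w w' hB hw hw' hne h1 h2 (mul_left_cancel₀ hε h3)

variable {s n : ℕ} {M : Matrix (Fin s) (Fin n) ℤ} {B : Finset (Fin n)} {T : Finset (Fin s → ℂ)}
  {D : ℝ} {γ : Fin s → ℝ}

theorem IsColBasis.dotProduct_coef {m : Fin n → Fin s → ℝ} (hB : IsColBasis m B) (u : Fin n → ℝ)
    (x : Fin s → ℝ) :
    u ⬝ᵥ coef m B x = (fun i => u ⬝ᵥ coef m B (Pi.single i 1)) ⬝ᵥ x := by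
  have hx : x = ∑ i, x i • (Pi.single i 1 : Fin s → ℝ) := by
    funext k
    simp [Finset.sum_apply, Pi.single_apply]
  conv_lhs => rw [hx, ← hB.coefₗ_apply, map_sum]
  simp only [_root_.map_smul]
  simp only [hB.coefₗ_apply]
  rw [dotProduct_sum]
  simp only [dotProduct_smul, smul_eq_mul]
  exact Finset.sum_congr rfl fun i _ => mul_comm _ _

theorem charP_one (y : Fin s → ℤ) : charP s (fun _ => 1) y = 1 := by
  simp [_root_.charP]

theorem IsDual.one_mem (hT : IsDual M B T D) : (fun _ => 1) ∈ T :=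
  (hT.mem_iff _).2 ⟨fun _ => one_ne_zero, fun _ _ => charP_one _⟩

/-- The part of `vertexTerm` coming from the nontrivial characters, for the cost `ε • u`. -/
noncomputable def regularTerm (M : Matrix (Fin s) (Fin n) ℤ) (u : Fin n → ℝ) (B : Finset (Fin n))
    (T : Finset (Fin s → ℂ)) (D : ℝ) (α : Fin s → ℤ) (ε : ℝ) : ℂ :=
  Complex.exp ((ε * (u ⬝ᵥ coef (col s n M) B (fun i => (α i : ℝ))) : ℝ) : ℂ) / (D : ℂ) *
    ∑ θ ∈ T.erase (fun _ => 1), charP s θ α *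
      ∏ w ∈ Bᶜ, (1 - Complex.exp ((ε * redCost (col s n M) u B w : ℝ) : ℂ) *
        charP s θ (fun i => -(M i w)))⁻¹

theorem IsDual.vertexTerm_smul (hT : IsDual M B T D) (hB : IsColBasis (col s n M) B)
    (u : Fin n → ℝ) (α : Fin s → ℤ) (ε : ℝ) :
    vertexTerm M (ε • u) B T D α =
      (1 / (D : ℂ)) * (Complex.exp (ε * ((fun i =>
        ((u ⬝ᵥ coef (col s n M) B (Pi.single i 1) : ℝ) : ℂ)) ⬝ᵥ fun i => (α i : ℂ))) *
        ∏ w ∈ Bᶜ, (1 - Complex.exp ((ε * redCost (col s n M) u B w : ℝ) : ℂ))⁻¹) +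
      regularTerm M u B T D α ε := by
  have hl : ((fun i => ((u ⬝ᵥ coef (col s n M) B (Pi.single i 1) : ℝ) : ℂ)) ⬝ᵥ
      fun i => (α i : ℂ)) = ((u ⬝ᵥ coef (col s n M) B (fun i => (α i : ℝ)) : ℝ) : ℂ) := by
    rw [hB.dotProduct_coef u]
    simp [dotProduct]
  rw [vertexTerm, regularTerm, ← Finset.add_sum_erase _ _ hT.one_mem, mul_add, hl]
  simp only [redCost_smul, smul_dotProduct, smul_eq_mul, charP_one, mul_one, one_mul]
  rw [← Complex.ofReal_mul]
  ring

theorem IsDual.tendsto_regularTerm (hT : IsDual M B T D) (hM : IsOnePrime s n M)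
    (hB : IsColBasis (col s n M) B) (u : Fin n → ℝ) (α : Fin s → ℤ) :
    Tendsto (regularTerm M u B T D α) (𝓝[>] 0) (𝓝 (∑ θ ∈ T.erase (fun _ => 1),
      charP s θ α * (1 / (D : ℂ)) * ∏ w ∈ Bᶜ, (1 - charP s θ (fun i => -(M i w)))⁻¹)) := by
  have hexp : ∀ c : ℝ, ContinuousAt (fun ε : ℝ => Complex.exp ((ε * c : ℝ) : ℂ)) 0 :=
    fun c => by fun_prop
  have hc : ContinuousAt (regularTerm M u B T D α) 0 := by
    refine ((hexp _).div_const _).mul (tendsto_finsetSum _ fun θ hθ => ?_)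
    refine tendsto_const_nhds.mul (tendsto_finsetProd _ fun w hw => ?_)
    refine ContinuousAt.inv₀ (continuousAt_const.sub ((hexp _).mul continuousAt_const)) ?_
    obtain ⟨hne, hθT⟩ := Finset.mem_erase.1 hθ
    obtain ⟨h0, hθB⟩ := (hT.mem_iff θ).1 hθT
    rw [zero_mul, Complex.ofReal_zero, Complex.exp_zero, one_mul, sub_ne_zero]
    intro h
    have hw' : charP s θ (fun i => M i w) = 1 := by
      have h1 : charP s θ (-fun i => M i w) = 1 := h.symm
      rwa [charP_neg h0, inv_eq_one] at h1
    rw [← mem_idxSet, hM.idxSet_eq hB h0 hθB hne] at hw'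
    exact Finset.mem_compl.1 hw hw'
  have h0 : regularTerm M u B T D α 0 = ∑ θ ∈ T.erase (fun _ => 1),
      charP s θ α * (1 / (D : ℂ)) * ∏ w ∈ Bᶜ, (1 - charP s θ (fun i => -(M i w)))⁻¹ := by
    simp only [regularTerm, zero_mul, Complex.ofReal_zero, Complex.exp_zero, one_mul,
      Finset.mul_sum]
    exact Finset.sum_congr rfl fun θ _ => by ring
  rw [← h0]
  exact hc.tendsto.mono_left nhdsWithin_le_nhds

/-- The counting formula, as a sum over the feasible bases. -/
theorem exists_polynomial_card_eq (hM : IsOnePrime s n M) (hm : IsPointed (col s n M))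
    (hγ : IsGeneric (col s n M) γ) (hne : ∃ B, Feasible (col s n M) γ B)
    {T : Finset (Fin n) → Finset (Fin s → ℂ)} {D : Finset (Fin n) → ℝ}
    (hT : ∀ B, IsColBasis (col s n M) B → IsDual M B (T B) (D B)) :
    ∃ P : MvPolynomial (Fin s) ℂ, P.totalDegree ≤ n - s ∧ ∀ α : Fin s → ℤ,
      (∀ B, Feasible (col s n M) γ B → ∀ j, 0 ≤ coef (col s n M) B (fun i => (α i : ℝ)) j) →
      ((hm.finite_solutions α).toFinset.card : ℂ) = MvPolynomial.eval (fun i => (α i : ℂ)) P +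
        ∑ B with Feasible (col s n M) γ B, ∑ θ ∈ (T B).erase (fun _ => 1),
          charP s θ α * (1 / (D B : ℂ)) * ∏ w ∈ Bᶜ, (1 - charP s θ (fun i => -(M i w)))⁻¹ := by
  obtain ⟨u, hu⟩ := exists_generic_cost (_root_.col s n M)
  have hK : ∀ B, Feasible (col s n M) γ B → ∃ K : ℂ → ℂ, AnalyticAt ℂ K 0 ∧ ∀ ε : ℝ, 0 < ε →
      ∏ w ∈ Bᶜ, (1 - Complex.exp ((ε * redCost (col s n M) u B w : ℝ) : ℂ))⁻¹ =
        K ε / (ε : ℂ) ^ (n - s) := by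
    intro B hB
    obtain ⟨K, h1, h2⟩ := exists_analyticAt_prod_one_sub_exp_inv Bᶜ
      (redCost (_root_.col s n M) u B)
      fun w hw => (hu w).ne_zero B w hB.1 (Finset.mem_compl.1 hw)
    refine ⟨K, h1, fun ε hε => ?_⟩
    rw [h2 ε hε, Finset.card_compl, Fintype.card_fin, hB.1.card_eq]
  choose! K hKa hKe using hK
  obtain ⟨P, hdeg, hP⟩ := exists_mvPolynomial_eq_limit
    (Finset.univ.filter fun B => Feasible (_root_.col s n M) γ B) (n - s)
    (fun B => 1 / (D B : ℂ))
    (fun B i => ((u ⬝ᵥ coef (_root_.col s n M) B (Pi.single i 1) : ℝ) : ℂ)) K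
    fun B hB => hKa B (Finset.mem_filter.1 hB).2
  refine ⟨P, hdeg, fun α hα => ?_⟩
  rw [← sub_eq_iff_eq_add]
  refine hP _ _ ?_
  have hcard : Tendsto (fun ε : ℝ => ∑ β ∈ (hm.finite_solutions α).toFinset,
      Complex.exp (((ε • u) ⬝ᵥ (fun j => (β j : ℝ)) : ℝ) : ℂ)) (𝓝[>] 0)
      (𝓝 ((hm.finite_solutions α).toFinset.card : ℂ)) := by
    have hc : Continuous fun ε : ℝ => ∑ β ∈ (hm.finite_solutions α).toFinset,
        Complex.exp (((ε • u) ⬝ᵥ (fun j => (β j : ℝ)) : ℝ) : ℂ) := by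
      simp only [smul_dotProduct, smul_eq_mul]
      fun_prop
    have h0 := (hc.tendsto 0).mono_left (nhdsWithin_le_nhds (s := Set.Ioi 0))
    simpa using h0
  have hreg := tendsto_finsetSum (Finset.univ.filter fun B => Feasible (_root_.col s n M) γ B)
    fun B hB => have hB' := (Finset.mem_filter.1 hB).2.1
      (hT B hB').tendsto_regularTerm hM hB' u α
  refine (hcard.sub hreg).congr' ?_
  filter_upwards [self_mem_nhdsWithin] with ε hε
  rw [sum_exp_eq_sum_vertexTerm hm hγ hne (fun j => (hu j).smul (ne_of_gt hε)) hT hα,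
    ← Finset.sum_sub_distrib, Finset.sum_div]
  refine Finset.sum_congr rfl fun B hB => ?_
  have hB' := (Finset.mem_filter.1 hB).2
  rw [(hT B hB'.1).vertexTerm_smul hB'.1, hKe B hB' ε hε]
  ring

end Assembly

/-- **Explicit formula for the discrete truncated power of a 1-prime matrix.**
There is a polynomial `P` of degree at most `n - s` such that on `closure(Ω) ∩ ℤˢ`,
`t(α|M) = P(α) + ∑_{θ ∈ A(M)∖{e}} θ^α (1/|det M_θ|) ∏_{w ∈ M∖M_θ} (1-θ^{-w})⁻¹ ·
1_{cone(M_θ)}(Ω)`. -/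
theorem discrete_truncated_power_one_prime (s n : ℕ) (hs : 1 ≤ s) (hn : s ≤ n)
    (M : Matrix (Fin s) (Fin n) ℤ)
    (hspan : Submodule.span ℝ (Set.range (col s n M)) = ⊤)
    (hhull : (0 : Fin s → ℝ) ∉ convexHull ℝ (Set.range (col s n M)))
    (hprime : IsOnePrime s n M)
    (Ω : Set (Fin s → ℝ)) (hΩ : IsFundCone s n M Ω) :
    ∃ P : MvPolynomial (Fin s) ℂ, P.totalDegree ≤ n - s ∧
      ∀ α : Fin s → ℤ, (fun i => (α i : ℝ)) ∈ closure Ω →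
        (Nat.card {β : Fin n → ℕ // ∀ i, ∑ j, M i j * (β j : ℤ) = α i} : ℂ) =
          MvPolynomial.eval (fun i => (α i : ℂ)) P +
            ∑ᶠ θ ∈ Aset s n M \ {fun _ => (1 : ℂ)},
              charP s θ α * (1 / (detAbs s n M θ : ℂ)) *
                (∏ j ∈ (idxSet s n M θ)ᶜ, (1 - charP s θ (fun i => -(M i j)))⁻¹) *
                (if (Ω ∩ coneOf s n M (idxSet s n M θ)).Nonempty then 1 else 0) := by
  have hm := isPointed_of_zero_notMem_convexHull hhull
  obtain ⟨γ, hγ, hcone, hiff, hcl⟩ := hΩ.exists_point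
  choose! T D hT using fun B (hB : IsColBasis (col s n M) B) => hB.exists_isDual
  obtain ⟨P, hdeg, hP⟩ :=
    exists_polynomial_card_eq hprime hm hγ (exists_feasible hm hγ hcone) hT
  refine ⟨P, hdeg, fun α hα => ?_⟩
  have hcard : Nat.card {β : Fin n → ℕ // ∀ i, ∑ j, M i j * (β j : ℤ) = α i} =
      (hm.finite_solutions α).toFinset.card :=
    Nat.card_eq_card_finite_toFinset (hm.finite_solutions α)
  rw [hcard, hP α fun B hB j => hcl B hB _ hα j]
  congr 1
  have hidx : ∀ B, IsColBasis (col s n M) B → ∀ θ ∈ (T B).erase (fun _ => 1),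
      idxSet s n M θ = B := fun B hB θ hθ =>
    hprime.idxSet_eq hB (((hT B hB).mem_iff θ).1 (Finset.mem_of_mem_erase hθ)).1
      (((hT B hB).mem_iff θ).1 (Finset.mem_of_mem_erase hθ)).2 (Finset.ne_of_mem_erase hθ)
  have hfeas : ∀ B ∈ Finset.univ.filter fun B => Feasible (_root_.col s n M) γ B,
      Feasible (_root_.col s n M) γ B := fun B hB => (Finset.mem_filter.1 hB).2
  set F : (Fin s → ℂ) → ℂ := fun θ => charP s θ α * (1 / (detAbs s n M θ : ℂ)) *
    (∏ j ∈ (idxSet s n M θ)ᶜ, (1 - charP s θ (fun i => -(M i j)))⁻¹) *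
    (if (Ω ∩ coneOf s n M (idxSet s n M θ)).Nonempty then 1 else 0) with hF
  have hfin : ∑ᶠ θ ∈ Aset s n M \ {fun _ => (1 : ℂ)}, F θ =
      ∑ θ ∈ (Finset.univ.filter fun B => Feasible (_root_.col s n M) γ B).biUnion
        fun B => (T B).erase (fun _ => 1), F θ := by
    refine finsum_mem_eq_sum_of_inter_support_eq _ (Set.ext fun θ => and_congr_left fun hθ => ?_)
    rw [Finset.mem_coe, Finset.mem_biUnion]
    constructor
    · rintro ⟨hA, hne⟩
      have hB := hprime.isColBasis_idxSet hA hne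
      have hΩB : (Ω ∩ coneOf s n M (idxSet s n M θ)).Nonempty := by
        by_contra h
        exact hθ (by rw [hF]; simp only [if_neg h, mul_zero])
      refine ⟨idxSet s n M θ, Finset.mem_filter.2 ⟨Finset.mem_univ _, (hiff _ hB).2 hΩB⟩,
        Finset.mem_erase.2 ⟨hne, ((hT _ hB).mem_iff θ).2 ⟨hA.1, fun j hj => mem_idxSet.1 hj⟩⟩⟩
    · rintro ⟨B, hB, hθB⟩
      have h := ((hT B (hfeas B hB).1).mem_iff θ).1 (Finset.mem_of_mem_erase hθB)
      exact ⟨(hfeas B hB).1.mem_Aset h.1 h.2, Finset.ne_of_mem_erase hθB⟩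
  rw [hfin, Finset.sum_biUnion]
  · refine Finset.sum_congr rfl fun B hB => Finset.sum_congr rfl fun θ hθ => ?_
    have hB' := (hfeas B hB).1
    have h := hidx B hB' θ hθ
    simp only [hF, h, (hT B hB').detAbs_eq θ h, if_pos ((hiff B hB').1 (hfeas B hB)), mul_one]
  · intro B hB B' hB' hne
    refine Finset.disjoint_left.2 fun θ hθ hθ' => hne ?_
    rw [← hidx B (hfeas B hB).1 θ hθ, hidx B' (hfeas B' hB').1 θ hθ']
end
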